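/- For d = 0 and every γ with 0 < γ ≤ 1/π there exist 0 < L_min(γ) ≤ L_max(γ) < ∞ such that: for every L ∈ (L_min(γ), L_max(γ)) there exist at least two distinct pinned fluxons for parameters (L, 0, γ), and at least one pinned fluxon exists for L = L_min(γ) and for L = L_max(γ); L_min(γ) → 0 and L_max(γ) → ∞ as γ ↓ 0; as γ ↑ 1/π, both L_min(γ) and L_max(γ) converge to √((π/2)(arcsin(1/π) + √(π²−1))) − √((π/2)(arcsin(1/π) + √(π²−1) − π)); for any fixed L ∈ [L_min(γ), L_max(γ)] the number of pinned fluxons existing simultaneously is at most 6; and for γ > 1/π no pinned fluxon exists for any L > 0. -/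

import Mathlib

open Real Filter Topology

/-- The piecewise-constant Josephson tunneling critical current:
`D(x) = d` for `|x| < L` and `D(x) = 1` for `|x| > L`. -/
noncomputable def Dfun (L d : ℝ) (x : ℝ) : ℝ := if |x| < L then d else 1

/-- A pinned fluxon for parameters `(L, d, γ)`. -/
def IsPinnedFluxon (L d γ : ℝ) (φ : ℝ → ℝ) : Prop :=
  ContDiff ℝ 1 φ ∧
  (∀ x : ℝ, x ≠ -L → x ≠ L →
    ∃ φ'' : ℝ, HasDerivAt (deriv φ) φ'' x ∧
      φ'' - Dfun L d x * Real.sin (φ x) + γ = 0) ∧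
  Tendsto φ atBot (𝓝 (Real.arcsin γ)) ∧
  Tendsto φ atTop (𝓝 (Real.arcsin γ + 2 * π)) ∧
  Tendsto (deriv φ) atBot (𝓝 0) ∧
  Tendsto (deriv φ) atTop (𝓝 0)

/-- The common limit of `L_min(γ)` and `L_max(γ)` as `γ ↑ 1/π`. -/
noncomputable def Lstar : ℝ :=
  Real.sqrt (π / 2 * (Real.arcsin (1 / π) + Real.sqrt (π ^ 2 - 1))) -
    Real.sqrt (π / 2 * (Real.arcsin (1 / π) + Real.sqrt (π ^ 2 - 1) - π))

/-- The energy level `cos a + γ a` of the saddle `a = arcsin γ`. -/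
noncomputable def saddleEnergy (γ : ℝ) : ℝ := Real.cos (Real.arcsin γ) + γ * Real.arcsin γ

/-- The kinetic energy `φ'² / 2` at angle `u` on the invariant manifolds of the saddle
`arcsin γ` of the homogeneous equation. -/
noncomputable def kineticEnergy (γ u : ℝ) : ℝ := saddleEnergy γ - Real.cos u - γ * u

/-- The angle in `[0, π]` with cosine `cos x + 2πγ`: if a fluxon enters the inhomogeneity at
angle `x`, then it leaves it at an angle with the same cosine. -/
noncomputable def exitAngle (γ x : ℝ) : ℝ := Real.arccos (Real.cos x + 2 * π * γ)

/-- The smallest angle at which a fluxon may enter the inhomogeneity. -/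
noncomputable def minAngle (γ : ℝ) : ℝ := Real.arccos (1 - 2 * π * γ)

lemma pi_mul_le_one {γ : ℝ} (h : γ ≤ 1 / π) : π * γ ≤ 1 := by
  rw [le_div_iff₀ Real.pi_pos] at h
  linarith

lemma lt_one_of_le_inv_pi {γ : ℝ} (h : γ ≤ 1 / π) : γ < 1 := by
  have := pi_mul_le_one h
  nlinarith [Real.pi_gt_three]

lemma sin_arcsin_of_le_inv_pi {γ : ℝ} (h0 : 0 < γ) (h : γ ≤ 1 / π) :
    Real.sin (Real.arcsin γ) = γ :=
  Real.sin_arcsin (by linarith) (lt_one_of_le_inv_pi h).le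

lemma arcsin_lt_pi_div_two_of_le_inv_pi {γ : ℝ} (h : γ ≤ 1 / π) : Real.arcsin γ < π / 2 :=
  Real.arcsin_lt_pi_div_two.2 (lt_one_of_le_inv_pi h)

lemma cos_arcsin_gt {γ : ℝ} (h0 : 0 < γ) (h : γ ≤ 1 / π) :
    1 - 2 * π * γ < Real.cos (Real.arcsin γ) := by
  have h1 := sin_arcsin_of_le_inv_pi h0 h
  have h2 := Real.sin_sq_add_cos_sq (Real.arcsin γ)
  have h3 := Real.cos_le_one (Real.arcsin γ)
  have h4 := Real.cos_arcsin_nonneg γ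
  have h5 := lt_one_of_le_inv_pi h
  rw [h1] at h2
  nlinarith [Real.pi_gt_three]

lemma one_lt_saddleEnergy {γ : ℝ} (h0 : 0 < γ) (h : γ ≤ 1 / π) : 1 < saddleEnergy γ := by
  have h1 := sin_arcsin_of_le_inv_pi h0 h
  have ha := arcsin_lt_pi_div_two_of_le_inv_pi h
  have h2 := Real.one_sub_sq_div_two_le_cos (x := Real.arcsin γ)
  have h3 := Real.arcsin_pos.2 h0
  have h4 := Real.mul_le_sin h3.le ha.le
  rw [h1] at h4
  have h5 : 1 / 2 < 2 / π := by
    rw [lt_div_iff₀ Real.pi_pos]; linarith [Real.pi_lt_four]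
  unfold saddleEnergy
  nlinarith [mul_pos h3 h3, mul_lt_mul_of_pos_right h5 h3]

lemma saddleEnergy_le {γ : ℝ} (h0 : 0 < γ) : saddleEnergy γ ≤ 1 + γ * (π / 2) := by
  have h3 := Real.cos_le_one (Real.arcsin γ)
  have := mul_le_mul_of_nonneg_left (Real.arcsin_le_pi_div_two γ) h0.le
  unfold saddleEnergy
  linarith

lemma hasDerivAt_kineticEnergy (γ u : ℝ) :
    HasDerivAt (kineticEnergy γ) (Real.sin u - γ) u := by
  have := (((hasDerivAt_const u (saddleEnergy γ)).sub (Real.hasDerivAt_cos u)).sub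
    ((hasDerivAt_id u).const_mul γ))
  refine this.congr_deriv ?_
  simp

lemma continuous_kineticEnergy (γ : ℝ) : Continuous (kineticEnergy γ) := by
  unfold kineticEnergy
  fun_prop

lemma continuous_exitAngle (γ : ℝ) : Continuous (exitAngle γ) := by
  unfold exitAngle
  fun_prop

lemma kineticEnergy_arcsin (γ : ℝ) : kineticEnergy γ (Real.arcsin γ) = 0 := by
  simp [kineticEnergy, saddleEnergy]

lemma sin_gt_of_mem {γ u : ℝ} (h0 : 0 < γ) (h : γ ≤ 1 / π)
    (h1 : Real.arcsin γ < u) (h2 : u < π - Real.arcsin γ) : γ < Real.sin u := by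
  have hs := sin_arcsin_of_le_inv_pi h0 h
  have ha := Real.arcsin_pos.2 h0
  rcases le_total u (π / 2) with hu | hu
  · rw [← hs]
    exact Real.sin_lt_sin_of_lt_of_le_pi_div_two (by linarith [Real.pi_pos]) hu h1
  · rw [← hs, ← Real.sin_pi_sub u]
    exact Real.sin_lt_sin_of_lt_of_le_pi_div_two (by linarith [Real.pi_pos]) (by linarith)
      (by linarith)

lemma sin_lt_of_mem {γ u : ℝ} (h0 : 0 < γ) (h : γ ≤ 1 / π)
    (h1 : -π ≤ u) (h2 : u < Real.arcsin γ) : Real.sin u < γ := by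
  have hs := sin_arcsin_of_le_inv_pi h0 h
  have ha := arcsin_lt_pi_div_two_of_le_inv_pi h
  rcases lt_or_ge u 0 with hu | hu
  · exact (Real.sin_nonpos_of_nonpos_of_neg_pi_le hu.le h1).trans_lt h0
  · rw [← hs]
    exact Real.sin_lt_sin_of_lt_of_le_pi_div_two (by linarith [Real.pi_pos]) ha.le h2

lemma kineticEnergy_strictAntiOn {γ : ℝ} (h0 : 0 < γ) (h : γ ≤ 1 / π) :
    StrictAntiOn (kineticEnergy γ) (Set.Icc (-π) (Real.arcsin γ)) := by
  refine strictAntiOn_of_deriv_neg (convex_Icc _ _) (continuous_kineticEnergy γ).continuousOn ?_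
  intro u hu
  rw [interior_Icc] at hu
  rw [(hasDerivAt_kineticEnergy γ u).deriv]
  linarith [sin_lt_of_mem h0 h hu.1.le hu.2]

lemma kineticEnergy_strictMonoOn {γ : ℝ} (h0 : 0 < γ) (h : γ ≤ 1 / π) :
    StrictMonoOn (kineticEnergy γ) (Set.Icc (Real.arcsin γ) (π - Real.arcsin γ)) := by
  refine strictMonoOn_of_deriv_pos (convex_Icc _ _) (continuous_kineticEnergy γ).continuousOn ?_
  intro u hu
  rw [interior_Icc] at hu
  rw [(hasDerivAt_kineticEnergy γ u).deriv]
  linarith [sin_gt_of_mem h0 h hu.1 hu.2]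

lemma kineticEnergy_antitoneOn {γ : ℝ} (h0 : 0 < γ) (h : γ ≤ 1 / π) :
    AntitoneOn (kineticEnergy γ) (Set.Icc (π - Real.arcsin γ) (2 * π)) := by
  refine antitoneOn_of_deriv_nonpos (convex_Icc _ _) (continuous_kineticEnergy γ).continuousOn
    (fun u _ => (hasDerivAt_kineticEnergy γ u).differentiableAt.differentiableWithinAt) ?_
  intro u hu
  rw [interior_Icc] at hu
  rw [(hasDerivAt_kineticEnergy γ u).deriv, ← Real.sin_pi_sub]
  linarith [sin_lt_of_mem h0 h (u := π - u) (by linarith [hu.2]) (by linarith [hu.1])]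

lemma kineticEnergy_pos_of_lt {γ u : ℝ} (h0 : 0 < γ) (h : γ ≤ 1 / π)
    (hu : u < Real.arcsin γ) : 0 < kineticEnergy γ u := by
  have ha := Real.arcsin_pos.2 h0
  rcases le_total (-π) u with h1 | h1
  · rw [← kineticEnergy_arcsin γ]
    exact kineticEnergy_strictAntiOn h0 h ⟨h1, hu.le⟩ ⟨by linarith [Real.pi_pos], le_rfl⟩ hu
  · have h2 := cos_arcsin_gt h0 h
    have h3 := one_lt_saddleEnergy h0 h
    have h4 := Real.cos_le_one u
    unfold kineticEnergy
    nlinarith [Real.pi_pos]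

lemma kineticEnergy_two_pi_neg {γ : ℝ} (h0 : 0 < γ) : kineticEnergy γ (2 * π) < 0 := by
  have := saddleEnergy_le h0
  unfold kineticEnergy
  rw [Real.cos_two_pi]
  nlinarith [Real.pi_pos, mul_pos Real.pi_pos h0]

lemma cos_minAngle {γ : ℝ} (h0 : 0 < γ) (h : γ ≤ 1 / π) :
    Real.cos (minAngle γ) = 1 - 2 * π * γ := by
  have := pi_mul_le_one h
  exact Real.cos_arccos (by linarith) (by nlinarith [Real.pi_pos])

lemma minAngle_pos {γ : ℝ} (h0 : 0 < γ) : 0 < minAngle γ :=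
  Real.arccos_pos.2 (by nlinarith [Real.pi_pos])

lemma minAngle_le_pi (γ : ℝ) : minAngle γ ≤ π := Real.arccos_le_pi _

lemma arcsin_lt_minAngle {γ : ℝ} (h0 : 0 < γ) (h : γ ≤ 1 / π) : Real.arcsin γ < minAngle γ := by
  have h1 := cos_arcsin_gt h0 h
  rw [← cos_minAngle h0 h] at h1
  by_contra! hc
  have := Real.cos_le_cos_of_nonneg_of_le_pi (minAngle_pos h0).le
    (by linarith [arcsin_lt_pi_div_two_of_le_inv_pi h, Real.pi_pos]) hc
  linarith

lemma cos_le_of_mem {γ x : ℝ} (h0 : 0 < γ) (h : γ ≤ 1 / π)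
    (h1 : minAngle γ ≤ x) (h2 : x ≤ 2 * π - minAngle γ) : Real.cos x ≤ 1 - 2 * π * γ := by
  rw [← cos_minAngle h0 h]
  have := minAngle_pos h0
  rcases le_total x π with hx | hx
  · exact Real.cos_le_cos_of_nonneg_of_le_pi this.le hx h1
  · rw [← Real.cos_two_pi_sub x]
    exact Real.cos_le_cos_of_nonneg_of_le_pi this.le (by linarith) (by linarith)

lemma cos_lt_of_mem {γ x : ℝ} (h0 : 0 < γ) (h : γ ≤ 1 / π)
    (h1 : minAngle γ < x) (h2 : x < 2 * π - minAngle γ) : Real.cos x < 1 - 2 * π * γ := by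
  rw [← cos_minAngle h0 h]
  have := minAngle_pos h0
  rcases le_total x π with hx | hx
  · exact Real.cos_lt_cos_of_nonneg_of_le_pi this.le hx h1
  · rw [← Real.cos_two_pi_sub x]
    exact Real.cos_lt_cos_of_nonneg_of_le_pi this.le (by linarith) (by linarith)

lemma mem_of_cos_le {γ x : ℝ} (hx0 : 0 ≤ x) (hx1 : x ≤ 2 * π)
    (hc : Real.cos x ≤ 1 - 2 * π * γ) : x ∈ Set.Icc (minAngle γ) (2 * π - minAngle γ) := by
  have key : ∀ y, 0 ≤ y → y ≤ π → Real.cos y ≤ 1 - 2 * π * γ → minAngle γ ≤ y := by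
    intro y h0 h1 h2
    rw [← Real.arccos_cos h0 h1]
    exact Real.arccos_le_arccos h2
  rcases le_total x π with hx | hx
  · have := key x hx0 hx hc
    exact ⟨this, by linarith⟩
  · have := key (2 * π - x) (by linarith) (by linarith) (by rwa [Real.cos_two_pi_sub])
    exact ⟨by linarith, by linarith⟩

lemma le_kineticEnergy_of_mem {γ x : ℝ} (h0 : 0 < γ) (h : γ ≤ 1 / π)
    (hx : x ∈ Set.Icc (minAngle γ) (2 * π - minAngle γ)) :
    saddleEnergy γ - 1 + γ * minAngle γ ≤ kineticEnergy γ x := by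
  have h1 := cos_le_of_mem h0 h hx.1 hx.2
  have := mul_le_mul_of_nonneg_left hx.2 h0.le
  unfold kineticEnergy
  linarith

lemma kineticEnergy_pos_of_mem {γ x : ℝ} (h0 : 0 < γ) (h : γ ≤ 1 / π)
    (hx : x ∈ Set.Icc (minAngle γ) (2 * π - minAngle γ)) : 0 < kineticEnergy γ x := by
  have := le_kineticEnergy_of_mem h0 h hx
  have := mul_pos h0 (minAngle_pos h0)
  linarith [one_lt_saddleEnergy h0 h]

lemma kineticEnergy_pos_of_mem_Ioc {γ x u : ℝ} (h0 : 0 < γ) (h : γ ≤ 1 / π)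
    (hx : x ∈ Set.Icc (minAngle γ) (2 * π - minAngle γ)) (h1 : Real.arcsin γ < u) (h2 : u ≤ x) :
    0 < kineticEnergy γ u := by
  have := minAngle_pos h0
  rcases le_total u (π - Real.arcsin γ) with hu | hu
  · rw [← kineticEnergy_arcsin γ]
    exact kineticEnergy_strictMonoOn h0 h ⟨le_rfl, by linarith⟩ ⟨h1.le, hu⟩ h1
  · exact (kineticEnergy_pos_of_mem h0 h hx).trans_le
      (kineticEnergy_antitoneOn h0 h ⟨hu, by linarith [hx.2]⟩ ⟨by linarith, by linarith [hx.2]⟩ h2)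

lemma kineticEnergy_pos_of_le_pi {γ u : ℝ} (h0 : 0 < γ) (h : γ ≤ 1 / π)
    (h1 : Real.arcsin γ < u) (h2 : u ≤ π) : 0 < kineticEnergy γ u :=
  kineticEnergy_pos_of_mem_Ioc h0 h
    ⟨minAngle_le_pi γ, by linarith [minAngle_le_pi γ]⟩ h1 h2

lemma encard_le_two_of_forall_lt {S : Set ℝ}
    (h : ∀ x ∈ S, ∀ y ∈ S, ∀ z ∈ S, x < y → y < z → False) : S.encard ≤ 2 := by
  by_contra! hc
  have h3 : (3 : ℕ∞) ≤ S.encard := by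
    have := Order.add_one_le_of_lt hc
    exact this
  obtain ⟨T, hTS, hT⟩ := Set.exists_subset_encard_eq h3
  obtain ⟨x, y, z, hxy, hxz, hyz, rfl⟩ := Set.encard_eq_three.1 hT
  have hx := hTS (show x ∈ ({x, y, z} : Set ℝ) by simp)
  have hy := hTS (show y ∈ ({x, y, z} : Set ℝ) by simp)
  have hz := hTS (show z ∈ ({x, y, z} : Set ℝ) by simp)
  rcases lt_or_gt_of_ne hxy with a | a <;> rcases lt_or_gt_of_ne hxz with b | b <;>
    rcases lt_or_gt_of_ne hyz with c | c
  · exact h x hx y hy z hz a c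
  · exact h x hx z hz y hy b c
  · linarith
  · exact h z hz x hx y hy b a
  · exact h y hy x hx z hz a b
  · linarith
  · exact h y hy z hz x hx c b
  · exact h z hz y hy x hx c a

/-- A function whose derivative has at most one zero takes every value at most twice. -/
lemma encard_fiber_le_two {I : Set ℝ} [I.OrdConnected] {f f' : ℝ → ℝ} (hf : ContinuousOn f I)
    (hd : ∀ x ∈ I, ∀ y ∈ I, ∀ u ∈ Set.Ioo x y, HasDerivAt f (f' u) u)
    (hz : ∀ x ∈ I, ∀ y ∈ I, ∀ u ∈ Set.Ioo x y, ∀ v ∈ Set.Ioo x y, u < v → f' u = 0 → f' v ≠ 0)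
    (c : ℝ) : {x ∈ I | f x = c}.encard ≤ 2 := by
  refine encard_le_two_of_forall_lt ?_
  rintro x ⟨hx, hfx⟩ y ⟨hy, hfy⟩ z ⟨hz', hfz⟩ hxy hyz
  obtain ⟨u, hu, hu0⟩ := exists_hasDerivAt_eq_zero hxy
    (hf.mono (Set.OrdConnected.out ‹_› hx hy)) (hfx.trans hfy.symm) (hd x hx y hy)
  obtain ⟨v, hv, hv0⟩ := exists_hasDerivAt_eq_zero hyz
    (hf.mono (Set.OrdConnected.out ‹_› hy hz')) (hfy.trans hfz.symm) (hd y hy z hz')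
  exact hz x hx z hz' u ⟨hu.1, hu.2.trans hyz⟩ v ⟨hxy.trans hv.1, hv.2⟩ (hu.2.trans hv.1) hu0 hv0

lemma cos_exitAngle {γ x : ℝ} (h0 : 0 < γ) (hx : Real.cos x ≤ 1 - 2 * π * γ) :
    Real.cos (exitAngle γ x) = Real.cos x + 2 * π * γ :=
  Real.cos_arccos (by nlinarith [Real.neg_one_le_cos x, Real.pi_pos]) (by linarith)

lemma exitAngle_nonneg (γ x : ℝ) : 0 ≤ exitAngle γ x := Real.arccos_nonneg _

lemma exitAngle_le_pi (γ x : ℝ) : exitAngle γ x ≤ π := Real.arccos_le_pi _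

lemma exitAngle_lt {γ x : ℝ} (h0 : 0 < γ) (h : γ ≤ 1 / π) (hx : Real.cos x ≤ 1 - 2 * π * γ) :
    exitAngle γ x < π - Real.arcsin γ := by
  have h1 := cos_arcsin_gt h0 h
  have ha := Real.arcsin_pos.2 h0
  have ha' := arcsin_lt_pi_div_two_of_le_inv_pi h
  by_contra! hc
  have h2 := Real.cos_le_cos_of_nonneg_of_le_pi (by linarith) (exitAngle_le_pi γ x) hc
  rw [cos_exitAngle h0 hx, Real.cos_pi_sub] at h2
  linarith [Real.neg_one_le_cos x]

lemma sin_exitAngle_pos {γ x : ℝ} (h0 : 0 < γ) (hx : Real.cos x < 1 - 2 * π * γ) :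
    0 < Real.sin (exitAngle γ x) := by
  refine Real.sin_pos_of_pos_of_lt_pi (Real.arccos_pos.2 (by linarith)) ?_
  refine lt_of_le_of_ne (Real.arccos_le_pi _) fun hc => ?_
  have := cos_exitAngle h0 hx.le
  rw [show exitAngle γ x = π from hc, Real.cos_pi] at this
  nlinarith [Real.neg_one_le_cos x, Real.pi_pos]

lemma hasDerivAt_exitAngle {γ x : ℝ} (h0 : 0 < γ) (hx : Real.cos x < 1 - 2 * π * γ) :
    HasDerivAt (exitAngle γ) (Real.sin x / Real.sin (exitAngle γ x)) x := by
  have h1 : Real.cos x + 2 * π * γ ≠ -1 := by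
    nlinarith [Real.neg_one_le_cos x, mul_pos Real.pi_pos h0]
  have h2 := (Real.hasDerivAt_arccos h1 (by linarith)).comp x
    ((Real.hasDerivAt_cos x).add_const (2 * π * γ))
  refine h2.congr_deriv ?_
  rw [exitAngle, Real.sin_arccos]
  ring

/-- The kinetic energy of a pendulum with torque `g` and total energy `k`. -/
noncomputable def pendulumEnergy (g k u : ℝ) : ℝ := k - Real.cos u - g * u

/-- Two branches of fluxons have stationary half-length exactly where their values of this
function agree. -/
noncomputable def slopeRatio (g k u : ℝ) : ℝ :=
  pendulumEnergy g k u * Real.sin u ^ 2 / (Real.sin u - g) ^ 2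

/-- The derivative of `slopeRatio` with respect to `-cos u`. -/
noncomputable def slopeRate (g k u : ℝ) : ℝ :=
  Real.sin u / (Real.sin u - g) -
    2 * g * Real.cos u * pendulumEnergy g k u / (Real.sin u - g) ^ 3

lemma hasDerivAt_pendulumEnergy (g k u : ℝ) :
    HasDerivAt (pendulumEnergy g k) (Real.sin u - g) u := by
  have := (((hasDerivAt_const u k).sub (Real.hasDerivAt_cos u)).sub
    ((hasDerivAt_id u).const_mul g))
  refine this.congr_deriv ?_
  simp

lemma continuous_pendulumEnergy (g k : ℝ) : Continuous (pendulumEnergy g k) := by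
  unfold pendulumEnergy
  fun_prop

lemma hasDerivAt_slopeRatio {g u : ℝ} (k : ℝ) (hu : Real.sin u ≠ g) :
    HasDerivAt (slopeRatio g k) (Real.sin u * slopeRate g k u) u := by
  have h1 : Real.sin u - g ≠ 0 := sub_ne_zero.2 hu
  have := ((hasDerivAt_pendulumEnergy g k u).mul ((Real.hasDerivAt_sin u).pow 2)).div
    (((Real.hasDerivAt_sin u).sub_const g).pow 2) (pow_ne_zero 2 h1)
  refine this.congr_deriv ?_
  simp only [slopeRate, Pi.pow_apply, Pi.mul_apply]
  field_simp
  ring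

/-- Twice `γ` times the half-length of the inhomogeneity for the fluxon entering at angle `x`
and leaving with kinetic energy `pendulumEnergy g k (exitAngle γ x)`. -/
noncomputable def speedDrop (γ g k x : ℝ) : ℝ :=
  Real.sqrt (2 * kineticEnergy γ x) - Real.sqrt (2 * pendulumEnergy g k (exitAngle γ x))

lemma continuous_speedDrop (γ g k : ℝ) : Continuous (speedDrop γ g k) := by
  have h1 := continuous_kineticEnergy γ
  have h2 := (continuous_pendulumEnergy g k).comp (continuous_exitAngle γ)
  exact (Real.continuous_sqrt.comp (h1.const_mul 2)).sub
    (Real.continuous_sqrt.comp (h2.const_mul 2))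

/-- The derivative of `speedDrop`. -/
noncomputable def speedDropDeriv (γ g k x : ℝ) : ℝ :=
  (Real.sin x - γ) / Real.sqrt (2 * kineticEnergy γ x) -
    Real.sin x / Real.sin (exitAngle γ x) * (Real.sin (exitAngle γ x) - g) /
      Real.sqrt (2 * pendulumEnergy g k (exitAngle γ x))

lemma hasDerivAt_speedDrop {γ g k x : ℝ} (h0 : 0 < γ) (hx : Real.cos x < 1 - 2 * π * γ)
    (h1 : 0 < kineticEnergy γ x) (h2 : 0 < pendulumEnergy g k (exitAngle γ x)) :
    HasDerivAt (speedDrop γ g k) (speedDropDeriv γ g k x) x := by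
  have e1 := ((hasDerivAt_kineticEnergy γ x).const_mul 2).sqrt (by positivity)
  have e2 := ((((hasDerivAt_pendulumEnergy g k (exitAngle γ x)).comp x
    (hasDerivAt_exitAngle h0 hx)).const_mul 2)).sqrt (by simp only [Function.comp]; positivity)
  refine (e1.sub e2).congr_deriv ?_
  simp only [speedDropDeriv, Function.comp]
  have a1 := (Real.sqrt_pos.2 (show 0 < 2 * kineticEnergy γ x by positivity)).ne'
  have a2 := (Real.sqrt_pos.2 (show 0 < 2 * pendulumEnergy g k (exitAngle γ x) by positivity)).ne'
  have a3 := (sin_exitAngle_pos h0 hx).ne'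
  field_simp

lemma slope_eq_of_speedDropDeriv_eq_zero {γ g k x : ℝ} (h0 : 0 < γ)
    (hx : Real.cos x < 1 - 2 * π * γ) (h1 : 0 < kineticEnergy γ x)
    (h2 : 0 < pendulumEnergy g k (exitAngle γ x)) (hz : speedDropDeriv γ g k x = 0) :
    (Real.sin x - γ) * (Real.sin (exitAngle γ x) *
        Real.sqrt (2 * pendulumEnergy g k (exitAngle γ x))) =
      Real.sin x * (Real.sin (exitAngle γ x) - g) * Real.sqrt (2 * kineticEnergy γ x) := by
  have a1 := (Real.sqrt_pos.2 (show 0 < 2 * kineticEnergy γ x by positivity)).ne'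
  have a2 := (Real.sqrt_pos.2 (show 0 < 2 * pendulumEnergy g k (exitAngle γ x) by positivity)).ne'
  have a3 := (sin_exitAngle_pos h0 hx).ne'
  unfold speedDropDeriv at hz
  field_simp at hz
  linarith

lemma slopeRatio_eq_of_speedDropDeriv_eq_zero {γ g k x : ℝ} (h0 : 0 < γ)
    (hx : Real.cos x < 1 - 2 * π * γ) (h1 : 0 < kineticEnergy γ x)
    (h2 : 0 < pendulumEnergy g k (exitAngle γ x)) (hs : Real.sin x ≠ γ)
    (hs' : Real.sin (exitAngle γ x) ≠ g) (hz : speedDropDeriv γ g k x = 0) :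
    slopeRatio γ (saddleEnergy γ) x = slopeRatio g k (exitAngle γ x) := by
  have e := congrArg (· ^ 2) (slope_eq_of_speedDropDeriv_eq_zero h0 hx h1 h2 hz)
  simp only [mul_pow] at e
  rw [Real.sq_sqrt (by positivity), Real.sq_sqrt (by positivity)] at e
  have b1 := sub_ne_zero.2 hs
  have b2 := sub_ne_zero.2 hs'
  change kineticEnergy γ x * Real.sin x ^ 2 / (Real.sin x - γ) ^ 2 = _
  unfold slopeRatio
  rw [div_eq_div_iff (by positivity) (by positivity)]
  linarith

lemma slopeRatio_not_eq_twice {γ g k u v : ℝ} (h0 : 0 < γ) (huv : u < v)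
    (hI : ∀ x ∈ Set.Icc u v, Real.cos x < 1 - 2 * π * γ ∧ Real.sin x < 0 ∧
      Real.sin (exitAngle γ x) ≠ g ∧
      slopeRate γ (saddleEnergy γ) x ≠ slopeRate g k (exitAngle γ x))
    (hu : slopeRatio γ (saddleEnergy γ) u = slopeRatio g k (exitAngle γ u))
    (hv : slopeRatio γ (saddleEnergy γ) v = slopeRatio g k (exitAngle γ v)) : False := by
  have hd : ∀ x ∈ Set.Icc u v, HasDerivAt
      (fun x => slopeRatio γ (saddleEnergy γ) x - slopeRatio g k (exitAngle γ x))
      (Real.sin x * (slopeRate γ (saddleEnergy γ) x - slopeRate g k (exitAngle γ x))) x := by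
    intro x hx
    obtain ⟨a1, a2, a3, -⟩ := hI x hx
    have e1 := hasDerivAt_slopeRatio (g := γ) (saddleEnergy γ) (u := x) (by linarith)
    have e2 := (hasDerivAt_slopeRatio k a3).comp x (hasDerivAt_exitAngle h0 a1)
    refine (e1.sub e2).congr_deriv ?_
    have := (sin_exitAngle_pos h0 a1).ne'
    field_simp
  obtain ⟨w, hw, hw0⟩ := exists_hasDerivAt_eq_zero huv
    (fun x hx => (hd x hx).continuousAt.continuousWithinAt) (by simp [hu, hv])
    (fun x hx => hd x (Set.Ioo_subset_Icc_self hx))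
  obtain ⟨-, a2, -, a4⟩ := hI w (Set.Ioo_subset_Icc_self hw)
  rcases mul_eq_zero.1 hw0 with h | h
  · exact a2.ne h
  · exact a4 (sub_eq_zero.1 h)

lemma exitAngle_lt_of_mem {γ x : ℝ} (h0 : 0 < γ) (h : γ ≤ 1 / π)
    (hx : x ∈ Set.Icc (minAngle γ) (2 * π - minAngle γ)) :
    exitAngle γ x < x ∧ exitAngle γ x < 2 * π - x := by
  have h1 := cos_le_of_mem h0 h hx.1 hx.2
  have h2 := cos_exitAngle h0 h1
  have h3 := minAngle_pos h0
  have h4 := exitAngle_le_pi γ x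
  have h5 := mul_pos Real.pi_pos h0
  constructor <;> by_contra! hc
  · have := Real.cos_le_cos_of_nonneg_of_le_pi (by linarith [hx.1]) h4 hc
    linarith
  · have := Real.cos_le_cos_of_nonneg_of_le_pi (by linarith [hx.2]) h4 hc
    rw [Real.cos_two_pi_sub] at this
    linarith

lemma exitAngle_le_or_le {γ x y z : ℝ} (hx : 0 ≤ x) (hz : z ≤ 2 * π) (hxy : x ≤ y)
    (hyz : y ≤ z) : exitAngle γ x ≤ exitAngle γ y ∨ exitAngle γ z ≤ exitAngle γ y := by
  rcases le_total y π with hy | hy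
  · left
    refine Real.arccos_le_arccos ?_
    linarith [Real.cos_le_cos_of_nonneg_of_le_pi hx hy hxy]
  · right
    refine Real.arccos_le_arccos ?_
    have := Real.cos_le_cos_of_nonneg_of_le_pi (x := 2 * π - z) (y := 2 * π - y) (by linarith)
      (by linarith) (by linarith)
    rw [Real.cos_two_pi_sub, Real.cos_two_pi_sub] at this
    linarith

lemma sin_neg_of_Icc {u v w : ℝ} (hu0 : 0 ≤ u) (hv : v < 2 * π) (hu : Real.sin u < 0)
    (hw : w ∈ Set.Icc u v) : Real.sin w < 0 := by
  have h1 : π < u := by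
    by_contra! hc
    linarith [Real.sin_nonneg_of_nonneg_of_le_pi hu0 hc]
  have := Real.sin_pos_of_pos_of_lt_pi (x := 2 * π - w) (by linarith [hw.2]) (by linarith [hw.1])
  rw [Real.sin_two_pi_sub] at this
  linarith

lemma cos_le_cos_of_Icc {u v w : ℝ} (hu0 : 0 ≤ u) (hv : v < 2 * π) (hu : Real.sin u < 0)
    (hw : w ∈ Set.Icc u v) : Real.cos w ≤ Real.cos v := by
  have h1 : π < u := by
    by_contra! hc
    linarith [Real.sin_nonneg_of_nonneg_of_le_pi hu0 hc]
  rw [← Real.cos_two_pi_sub w, ← Real.cos_two_pi_sub v]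
  exact Real.cos_le_cos_of_nonneg_of_le_pi (by linarith) (by linarith [hw.1]) (by linarith [hw.2])

lemma pendulumEnergy_exitAngle_lt {γ κ x : ℝ} (h0 : 0 < γ) (h : γ ≤ 1 / π) (hκ : 0 ≤ κ)
    (hx : x ∈ Set.Icc (minAngle γ) (2 * π - minAngle γ)) :
    pendulumEnergy (-γ) (saddleEnergy γ - κ) (exitAngle γ x) < kineticEnergy γ x := by
  have h1 := cos_exitAngle h0 (cos_le_of_mem h0 h hx.1 hx.2)
  have h2 := mul_lt_mul_of_pos_left (exitAngle_lt_of_mem h0 h hx).2 h0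
  unfold pendulumEnergy kineticEnergy
  rw [h1]
  linarith

lemma sin_neg_and_cos_lt_of_speedDropDeriv_eq_zero {γ κ x : ℝ} (h0 : 0 < γ) (h : γ ≤ 1 / π)
    (hκ : 0 ≤ κ) (hx : x ∈ Set.Ioo (minAngle γ) (2 * π - minAngle γ))
    (hp : 0 < pendulumEnergy (-γ) (saddleEnergy γ - κ) (exitAngle γ x))
    (hz : speedDropDeriv γ (-γ) (saddleEnergy γ - κ) x = 0) :
    Real.sin x < 0 ∧ Real.cos x < -(π * γ) := by
  have hx' := Set.Ioo_subset_Icc_self hx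
  have hc := cos_lt_of_mem h0 h hx.1 hx.2
  have hk := kineticEnergy_pos_of_mem h0 h hx'
  have e := slope_eq_of_speedDropDeriv_eq_zero h0 hc hk hp hz
  have hs' := sin_exitAngle_pos h0 hc
  have hlt := Real.sqrt_lt_sqrt (by positivity)
    (mul_lt_mul_of_pos_left (pendulumEnergy_exitAngle_lt h0 h hκ hx') two_pos)
  have hp2 := Real.sqrt_pos.2 (mul_pos two_pos hp)
  have hcos := cos_exitAngle h0 hc.le
  have q1 := Real.sin_sq_add_cos_sq x
  have q2 := Real.sin_sq_add_cos_sq (exitAngle γ x)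
  rw [hcos] at q2
  set s' := Real.sin (exitAngle γ x)
  set p₂ := Real.sqrt (2 * pendulumEnergy (-γ) (saddleEnergy γ - κ) (exitAngle γ x))
  set p₁ := Real.sqrt (2 * kineticEnergy γ x)
  have hneg : Real.sin x < 0 := by
    by_contra! hs
    have a1 : 0 < γ * (s' * p₂) := by positivity
    have a2 : Real.sin x * s' * p₂ ≤ Real.sin x * s' * p₁ :=
      mul_le_mul_of_nonneg_left hlt.le (by positivity)
    have a3 : 0 ≤ Real.sin x * γ * p₁ := by
      have := hp2.trans hlt
      positivity
    linarith
  refine ⟨hneg, ?_⟩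
  have a1 : -Real.sin x * (s' + γ) * p₂ < -Real.sin x * (s' + γ) * p₁ :=
    mul_lt_mul_of_pos_left hlt (mul_pos (by linarith) (by linarith))
  have a2 : (-Real.sin x * (s' + γ)) * p₂ < ((-Real.sin x + γ) * s') * p₂ := by linarith
  have a3 := lt_of_mul_lt_mul_right a2 hp2.le
  have a4 : -Real.sin x < s' := lt_of_mul_lt_mul_left (a := γ) (by linarith) h0.le
  have a5 : Real.sin x ^ 2 < s' ^ 2 := by
    rw [← neg_sq (Real.sin x)]
    exact pow_lt_pow_left₀ a4 (by linarith) two_ne_zero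
  have a6 : 0 < 4 * (π * γ) * (-(π * γ) - Real.cos x) := by linarith
  have := pos_of_mul_pos_right a6 (by positivity)
  linarith

lemma slopeRate_lt_slopeRate_exitAngle {γ κ x : ℝ} (h0 : 0 < γ) (h : γ ≤ 1 / π)
    (hκ : 0 ≤ κ) (hx : x ∈ Set.Ioo (minAngle γ) (2 * π - minAngle γ))
    (hp : 0 < pendulumEnergy (-γ) (saddleEnergy γ - κ) (exitAngle γ x))
    (hs : Real.sin x < 0) (hcx : Real.cos x < -(π * γ)) :
    slopeRate γ (saddleEnergy γ) x <
      slopeRate (-γ) (saddleEnergy γ - κ) (exitAngle γ x) := by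
  have hx' := Set.Ioo_subset_Icc_self hx
  have hc := cos_lt_of_mem h0 h hx.1 hx.2
  have hs' := sin_exitAngle_pos h0 hc
  have hlt := pendulumEnergy_exitAngle_lt h0 h hκ hx'
  have hcos := cos_exitAngle h0 hc.le
  have q1 := Real.sin_sq_add_cos_sq x
  have q2 := Real.sin_sq_add_cos_sq (exitAngle γ x)
  rw [hcos] at q2
  have hpi := mul_pos Real.pi_pos h0
  change _ < kineticEnergy γ x at hlt
  unfold slopeRate
  change _ - 2 * γ * Real.cos x * kineticEnergy γ x / _ < _
  rw [hcos]
  set s' := Real.sin (exitAngle γ x)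
  set H := pendulumEnergy (-γ) (saddleEnergy γ - κ) (exitAngle γ x)
  set P := kineticEnergy γ x
  obtain ⟨s, hsdef⟩ : ∃ s, s = -Real.sin x := ⟨_, rfl⟩
  have hsx : Real.sin x = -s := by linarith
  rw [hsx] at q1 ⊢
  set c := Real.cos x
  have hspos : 0 < s := by linarith
  have hss : s < s' := by
    refine lt_of_pow_lt_pow_left₀ 2 hs'.le ?_
    nlinarith
  have b1 : -s / (-s - γ) = 1 - γ / (s + γ) := by
    have : s + γ ≠ 0 := by positivity
    have : -s - γ ≠ 0 := by linarith [show 0 < s + γ by positivity] |> ne_of_lt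
    field_simp
    ring
  have b2 : s' / (s' - -γ) = 1 - γ / (s' + γ) := by
    have : s' + γ ≠ 0 := by positivity
    rw [sub_neg_eq_add]
    field_simp
    ring
  have b3 : 2 * γ * c * P / (-s - γ) ^ 3 = 2 * γ * (-c * P / (s + γ) ^ 3) := by
    rw [show (-s - γ) ^ 3 = -(s + γ) ^ 3 by ring]
    field_simp
  have b4 : 2 * -γ * (c + 2 * π * γ) * H / (s' - -γ) ^ 3 =
      2 * γ * (-(c + 2 * π * γ) * H / (s' + γ) ^ 3) := by
    rw [sub_neg_eq_add]
    ring
  rw [b1, b2, b3, b4]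
  have d1 : γ / (s' + γ) < γ / (s + γ) := div_lt_div_of_pos_left h0 (by positivity) (by linarith)
  have d2 : -(c + 2 * π * γ) * H / (s' + γ) ^ 3 ≤ -c * P / (s + γ) ^ 3 := by
    have hP : 0 ≤ P := (hp.trans hlt).le
    rcases le_total 0 (c + 2 * π * γ) with hc' | hc'
    · refine (div_nonpos_of_nonpos_of_nonneg ?_ (by positivity)).trans
        (div_nonneg (mul_nonneg (by linarith) hP) (by positivity))
      exact mul_nonpos_of_nonpos_of_nonneg (by linarith) hp.le
    · refine div_le_div₀ (mul_nonneg (by linarith) hP) ?_ (by positivity) ?_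
      · exact mul_le_mul (by linarith) hlt.le hp.le (by linarith)
      · exact pow_le_pow_left₀ (by positivity) (by linarith) 3
  have d3 := mul_le_mul_of_nonneg_left d2 (show 0 ≤ 2 * γ by positivity)
  linarith

lemma pendulumEnergy_neg_monotoneOn {γ : ℝ} (h0 : 0 < γ) (k : ℝ) :
    MonotoneOn (pendulumEnergy (-γ) k) (Set.Icc 0 π) := by
  refine monotoneOn_of_deriv_nonneg (convex_Icc _ _)
    (continuous_pendulumEnergy _ k).continuousOn
    (fun u _ => (hasDerivAt_pendulumEnergy _ k u).differentiableAt.differentiableWithinAt) ?_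
  intro u hu
  rw [interior_Icc] at hu
  rw [(hasDerivAt_pendulumEnergy _ k u).deriv]
  linarith [Real.sin_nonneg_of_nonneg_of_le_pi hu.1.le hu.2.le]

/-- Fluxons leaving the inhomogeneity on the falling part of a period. -/
lemma encard_speedDrop_neg_le_two {γ κ : ℝ} (h0 : 0 < γ) (h : γ ≤ 1 / π) (hκ : 0 ≤ κ) (c : ℝ) :
    {x ∈ {x ∈ Set.Icc (minAngle γ) (2 * π - minAngle γ) |
        0 < pendulumEnergy (-γ) (saddleEnergy γ - κ) (exitAngle γ x)} |
      speedDrop γ (-γ) (saddleEnergy γ - κ) x = c}.encard ≤ 2 := by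
  have hθ := minAngle_pos h0
  have : Set.OrdConnected {x ∈ Set.Icc (minAngle γ) (2 * π - minAngle γ) |
      0 < pendulumEnergy (-γ) (saddleEnergy γ - κ) (exitAngle γ x)} := by
    refine ⟨fun x hx z hz y hy => ⟨⟨hx.1.1.trans hy.1, hy.2.trans hz.1.2⟩, ?_⟩⟩
    have hm := pendulumEnergy_neg_monotoneOn h0 (saddleEnergy γ - κ)
    have hmem : ∀ t, exitAngle γ t ∈ Set.Icc 0 π := fun t =>
      ⟨exitAngle_nonneg γ t, exitAngle_le_pi γ t⟩
    rcases exitAngle_le_or_le (γ := γ) (hθ.le.trans hx.1.1) (by linarith [hz.1.2]) hy.1 hy.2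
      with hc | hc
    · exact hx.2.trans_le (hm (hmem _) (hmem _) hc)
    · exact hz.2.trans_le (hm (hmem _) (hmem _) hc)
  have hint : ∀ x ∈ {x ∈ Set.Icc (minAngle γ) (2 * π - minAngle γ) |
      0 < pendulumEnergy (-γ) (saddleEnergy γ - κ) (exitAngle γ x)},
      ∀ y ∈ {x ∈ Set.Icc (minAngle γ) (2 * π - minAngle γ) |
      0 < pendulumEnergy (-γ) (saddleEnergy γ - κ) (exitAngle γ x)}, ∀ u ∈ Set.Ioo x y,
      u ∈ Set.Ioo (minAngle γ) (2 * π - minAngle γ) ∧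
      0 < pendulumEnergy (-γ) (saddleEnergy γ - κ) (exitAngle γ u) := fun x hx y hy u hu =>
    ⟨⟨hx.1.1.trans_lt hu.1, hu.2.trans_le hy.1.2⟩,
      (this.out hx hy (Set.Ioo_subset_Icc_self hu)).2⟩
  refine encard_fiber_le_two (f' := speedDropDeriv γ (-γ) (saddleEnergy γ - κ))
    (continuous_speedDrop _ _ _).continuousOn ?_ ?_ c
  · intro x hx y hy u hu
    obtain ⟨h1, h2⟩ := hint x hx y hy u hu
    exact hasDerivAt_speedDrop h0 (cos_lt_of_mem h0 h h1.1 h1.2)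
      (kineticEnergy_pos_of_mem h0 h (Set.Ioo_subset_Icc_self h1)) h2
  · intro x hx y hy u hu v hv huv hu0 hv0
    obtain ⟨u1, u2⟩ := hint x hx y hy u hu
    obtain ⟨v1, v2⟩ := hint x hx y hy v hv
    obtain ⟨su, -⟩ := sin_neg_and_cos_lt_of_speedDropDeriv_eq_zero h0 h hκ u1 u2 hu0
    obtain ⟨sv, cv⟩ := sin_neg_and_cos_lt_of_speedDropDeriv_eq_zero h0 h hκ v1 v2 hv0
    have hratio : ∀ t ∈ Set.Ioo (minAngle γ) (2 * π - minAngle γ), Real.sin t < 0 →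
        0 < pendulumEnergy (-γ) (saddleEnergy γ - κ) (exitAngle γ t) →
        speedDropDeriv γ (-γ) (saddleEnergy γ - κ) t = 0 →
        slopeRatio γ (saddleEnergy γ) t =
          slopeRatio (-γ) (saddleEnergy γ - κ) (exitAngle γ t) := fun t t1 ts t2 t0 => by
      have tc := cos_lt_of_mem h0 h t1.1 t1.2
      exact slopeRatio_eq_of_speedDropDeriv_eq_zero h0 tc
        (kineticEnergy_pos_of_mem h0 h (Set.Ioo_subset_Icc_self t1)) t2 (by linarith)
        (by linarith [sin_exitAngle_pos h0 tc]) t0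
    refine slopeRatio_not_eq_twice h0 huv ?_ (hratio u u1 su u2 hu0) (hratio v v1 sv v2 hv0)
    intro w hw
    obtain ⟨w1, w2⟩ := hint x hx y hy w ⟨hu.1.trans_le hw.1, hw.2.trans_lt hv.2⟩
    have wc := cos_lt_of_mem h0 h w1.1 w1.2
    have hu_nonneg : 0 ≤ u := by linarith [u1.1]
    have hv_lt : v < 2 * π := by linarith [v1.2]
    have ws := sin_neg_of_Icc hu_nonneg hv_lt su hw
    have wv := cos_le_cos_of_Icc hu_nonneg hv_lt su hw
    exact ⟨wc, ws, by linarith [sin_exitAngle_pos h0 wc],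
      (slopeRate_lt_slopeRate_exitAngle h0 h hκ w1 w2 ws (by linarith)).ne⟩

lemma two_mul_cos_mul_kineticEnergy_lt {γ x : ℝ} (h0 : 0 < γ) (h : γ ≤ 1 / π)
    (h1 : Real.arcsin γ < x) (h2 : x < π - Real.arcsin γ) :
    2 * Real.cos x * kineticEnergy γ x < (Real.sin x - γ) ^ 2 := by
  have ha := Real.arcsin_pos.2 h0
  have hsq : 0 < (Real.sin x - γ) ^ 2 := by
    have := sin_gt_of_mem h0 h h1 h2
    exact pow_pos (by linarith) 2
  rcases le_total (Real.cos x) 0 with hc | hc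
  · have hk := kineticEnergy_pos_of_le_pi h0 h h1 (by linarith)
    nlinarith
  · have hd : ∀ u, HasDerivAt
        (fun u => (Real.sin u - γ) ^ 2 - 2 * Real.cos u * kineticEnergy γ u)
        (2 * Real.sin u * kineticEnergy γ u) u := by
      intro u
      refine ((((Real.hasDerivAt_sin u).sub_const γ).pow 2).sub
        (((Real.hasDerivAt_cos u).const_mul 2).mul (hasDerivAt_kineticEnergy γ u))).congr_deriv ?_
      simp
      ring
    have hm : StrictMonoOn (fun u => (Real.sin u - γ) ^ 2 - 2 * Real.cos u * kineticEnergy γ u)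
        (Set.Icc (Real.arcsin γ) x) := by
      refine strictMonoOn_of_deriv_pos (convex_Icc _ _)
        (fun u _ => (hd u).continuousAt.continuousWithinAt) ?_
      intro u hu
      rw [interior_Icc] at hu
      rw [(hd u).deriv]
      have := kineticEnergy_pos_of_le_pi h0 h hu.1 (by linarith [hu.2])
      have := Real.sin_pos_of_pos_of_lt_pi (by linarith [hu.1]) (show u < π by linarith [hu.2])
      positivity
    have := hm ⟨le_rfl, h1.le⟩ ⟨h1.le, le_rfl⟩ h1
    simp only [kineticEnergy_arcsin, sin_arcsin_of_le_inv_pi h0 h] at this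
    linarith

lemma one_lt_slopeRate {γ x : ℝ} (h0 : 0 < γ) (h : γ ≤ 1 / π)
    (h1 : Real.arcsin γ < x) (h2 : x < π - Real.arcsin γ) :
    1 < slopeRate γ (saddleEnergy γ) x := by
  have hlt := two_mul_cos_mul_kineticEnergy_lt h0 h h1 h2
  have hs := sub_pos.2 (sin_gt_of_mem h0 h h1 h2)
  unfold slopeRate
  change _ < _ - 2 * γ * Real.cos x * kineticEnergy γ x / _
  have e : Real.sin x / (Real.sin x - γ) -
      2 * γ * Real.cos x * kineticEnergy γ x / (Real.sin x - γ) ^ 3 =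
      1 + γ * ((Real.sin x - γ) ^ 2 - 2 * Real.cos x * kineticEnergy γ x) /
        (Real.sin x - γ) ^ 3 := by
    have := hs.ne'
    field_simp
    ring
  rw [e]
  have : 0 < γ * ((Real.sin x - γ) ^ 2 - 2 * Real.cos x * kineticEnergy γ x) /
        (Real.sin x - γ) ^ 3 := div_pos (mul_pos h0 (by linarith)) (by positivity)
  linarith

lemma slopeRate_lt_one {γ x : ℝ} (h0 : 0 < γ) (h : γ ≤ 1 / π)
    (hx : x ∈ Set.Ioo (minAngle γ) (2 * π - minAngle γ)) (hs : Real.sin x < 0) :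
    slopeRate γ (saddleEnergy γ) x < 1 := by
  have hx' := Set.Ioo_subset_Icc_self hx
  have hP := kineticEnergy_pos_of_mem h0 h hx'
  have hc := cos_lt_of_mem h0 h hx.1 hx.2
  have hxpi : π < x := by
    by_contra! hcon
    linarith [Real.sin_nonneg_of_nonneg_of_le_pi ((minAngle_pos h0).le.trans hx'.1) hcon]
  have hpi := mul_pos Real.pi_pos h0
  have hlt : 2 * Real.cos x * kineticEnergy γ x < (Real.sin x - γ) ^ 2 := by
    rcases le_total (Real.cos x) 0 with hc0 | hc0
    · have : 0 < (Real.sin x - γ) ^ 2 := by nlinarith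
      nlinarith
    · have hV := saddleEnergy_le h0
      have q := Real.sin_sq_add_cos_sq x
      have b1 : kineticEnergy γ x ≤ 1 - Real.cos x - π * γ / 2 := by
        unfold kineticEnergy
        nlinarith
      have b2 : 2 * Real.cos x * kineticEnergy γ x ≤
          2 * Real.cos x * (1 - Real.cos x - π * γ / 2) :=
        mul_le_mul_of_nonneg_left b1 (by linarith)
      nlinarith [sq_nonneg (1 - Real.cos x), mul_nonneg hc0 hpi.le]
  unfold slopeRate
  change _ - 2 * γ * Real.cos x * kineticEnergy γ x / _ < _
  have hne : 0 < γ - Real.sin x := by linarith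
  have e : Real.sin x / (Real.sin x - γ) -
      2 * γ * Real.cos x * kineticEnergy γ x / (Real.sin x - γ) ^ 3 =
      1 - γ * ((Real.sin x - γ) ^ 2 - 2 * Real.cos x * kineticEnergy γ x) /
        (γ - Real.sin x) ^ 3 := by
    have h1 : (Real.sin x - γ) ≠ 0 := by linarith
    have h2 : γ - Real.sin x ≠ 0 := hne.ne'
    rw [show γ - Real.sin x = -(Real.sin x - γ) by ring, Odd.neg_pow (by decide)]
    field_simp
    ring
  rw [e]
  have : 0 < γ * ((Real.sin x - γ) ^ 2 - 2 * Real.cos x * kineticEnergy γ x) /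
        (γ - Real.sin x) ^ 3 := div_pos (mul_pos h0 (by linarith)) (by positivity)
  linarith

lemma slopeRatio_strictMonoOn {γ : ℝ} (h0 : 0 < γ) (h : γ ≤ 1 / π) :
    StrictMonoOn (slopeRatio γ (saddleEnergy γ))
      (Set.Ioo (Real.arcsin γ) (π - Real.arcsin γ)) := by
  have hd : ∀ u ∈ Set.Ioo (Real.arcsin γ) (π - Real.arcsin γ), HasDerivAt
      (slopeRatio γ (saddleEnergy γ)) (Real.sin u * slopeRate γ (saddleEnergy γ) u) u :=
    fun u hu => hasDerivAt_slopeRatio _ (sin_gt_of_mem h0 h hu.1 hu.2).ne'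
  refine strictMonoOn_of_deriv_pos (convex_Ioo _ _)
    (fun u hu => (hd u hu).continuousAt.continuousWithinAt) ?_
  intro u hu
  rw [interior_Ioo] at hu
  rw [(hd u hu).deriv]
  exact mul_pos (h0.trans (sin_gt_of_mem h0 h hu.1 hu.2))
    (one_pos.trans (one_lt_slopeRate h0 h hu.1 hu.2))

lemma sin_neg_of_speedDropDeriv_eq_zero {γ x : ℝ} (h0 : 0 < γ) (h : γ ≤ 1 / π)
    (hx : x ∈ Set.Ioo (minAngle γ) (2 * π - minAngle γ)) (hp : Real.arcsin γ < exitAngle γ x)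
    (hz : speedDropDeriv γ γ (saddleEnergy γ) x = 0) : Real.sin x < 0 := by
  have hx' := Set.Ioo_subset_Icc_self hx
  have hc := cos_lt_of_mem h0 h hx.1 hx.2
  have hk := kineticEnergy_pos_of_mem h0 h hx'
  have hk' : 0 < pendulumEnergy γ (saddleEnergy γ) (exitAngle γ x) :=
    kineticEnergy_pos_of_le_pi h0 h hp (exitAngle_le_pi γ x)
  have he := exitAngle_lt h0 h hc.le
  have hs' := sin_gt_of_mem h0 h hp he
  have e := slope_eq_of_speedDropDeriv_eq_zero h0 hc hk hk' hz
  have hp2 := Real.sqrt_pos.2 (mul_pos two_pos hk')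
  have hp1 := Real.sqrt_pos.2 (mul_pos two_pos hk)
  have hpos := mul_pos (h0.trans hs') hp2
  by_contra! hs
  have hsx : 0 < Real.sin x := by
    refine lt_of_le_of_ne hs fun h' => ?_
    rw [← h'] at e
    nlinarith
  have hγ : γ < Real.sin x := by
    have : 0 < (Real.sin x - γ) * (Real.sin (exitAngle γ x) *
        Real.sqrt (2 * pendulumEnergy γ (saddleEnergy γ) (exitAngle γ x))) := by
      rw [e]
      exact mul_pos (mul_pos hsx (by linarith)) hp1
    linarith [pos_of_mul_pos_left this hpos.le]
  have hxlt : x < π - Real.arcsin γ := by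
    by_contra! hcon
    have : Real.sin (π - x) ≤ γ := by
      rcases hcon.lt_or_eq with h1 | h1
      · exact (sin_lt_of_mem h0 h (by linarith [hx.2, minAngle_pos h0]) (by linarith)).le
      · rw [← h1, sub_sub_cancel, sin_arcsin_of_le_inv_pi h0 h]
    rw [Real.sin_pi_sub] at this
    linarith
  have hr := slopeRatio_eq_of_speedDropDeriv_eq_zero h0 hc hk hk' hγ.ne' hs'.ne' hz
  exact (slopeRatio_strictMonoOn h0 h ⟨hp, he⟩
    ⟨(arcsin_lt_minAngle h0 h).trans hx.1, hxlt⟩ (exitAngle_lt_of_mem h0 h hx').1).ne' hr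

/-- Fluxons leaving the inhomogeneity on the rising part of the following period. -/
lemma encard_speedDrop_le_two {γ : ℝ} (h0 : 0 < γ) (h : γ ≤ 1 / π) (c : ℝ) :
    {x ∈ {x ∈ Set.Icc (minAngle γ) (2 * π - minAngle γ) | Real.arcsin γ < exitAngle γ x} |
      speedDrop γ γ (saddleEnergy γ) x = c}.encard ≤ 2 := by
  have hθ := minAngle_pos h0
  have : Set.OrdConnected {x ∈ Set.Icc (minAngle γ) (2 * π - minAngle γ) |
      Real.arcsin γ < exitAngle γ x} := by
    refine ⟨fun x hx z hz y hy => ⟨⟨hx.1.1.trans hy.1, hy.2.trans hz.1.2⟩, ?_⟩⟩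
    rcases exitAngle_le_or_le (γ := γ) (hθ.le.trans hx.1.1) (by linarith [hz.1.2]) hy.1 hy.2
      with hc | hc
    · exact hx.2.trans_le hc
    · exact hz.2.trans_le hc
  have hint : ∀ x ∈ {x ∈ Set.Icc (minAngle γ) (2 * π - minAngle γ) |
      Real.arcsin γ < exitAngle γ x},
      ∀ y ∈ {x ∈ Set.Icc (minAngle γ) (2 * π - minAngle γ) |
      Real.arcsin γ < exitAngle γ x}, ∀ u ∈ Set.Ioo x y,
      u ∈ Set.Ioo (minAngle γ) (2 * π - minAngle γ) ∧ Real.arcsin γ < exitAngle γ u :=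
    fun x hx y hy u hu => ⟨⟨hx.1.1.trans_lt hu.1, hu.2.trans_le hy.1.2⟩,
      (this.out hx hy (Set.Ioo_subset_Icc_self hu)).2⟩
  refine encard_fiber_le_two (f' := speedDropDeriv γ γ (saddleEnergy γ))
    (continuous_speedDrop _ _ _).continuousOn ?_ ?_ c
  · intro x hx y hy u hu
    obtain ⟨h1, h2⟩ := hint x hx y hy u hu
    exact hasDerivAt_speedDrop h0 (cos_lt_of_mem h0 h h1.1 h1.2)
      (kineticEnergy_pos_of_mem h0 h (Set.Ioo_subset_Icc_self h1))
      (kineticEnergy_pos_of_le_pi h0 h h2 (exitAngle_le_pi γ u))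
  · intro x hx y hy u hu v hv huv hu0 hv0
    obtain ⟨u1, u2⟩ := hint x hx y hy u hu
    obtain ⟨v1, v2⟩ := hint x hx y hy v hv
    have su := sin_neg_of_speedDropDeriv_eq_zero h0 h u1 u2 hu0
    have sv := sin_neg_of_speedDropDeriv_eq_zero h0 h v1 v2 hv0
    have hratio : ∀ t ∈ Set.Ioo (minAngle γ) (2 * π - minAngle γ), Real.sin t < 0 →
        Real.arcsin γ < exitAngle γ t → speedDropDeriv γ γ (saddleEnergy γ) t = 0 →
        slopeRatio γ (saddleEnergy γ) t = slopeRatio γ (saddleEnergy γ) (exitAngle γ t) :=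
      fun t t1 ts t2 t0 => by
        have tc := cos_lt_of_mem h0 h t1.1 t1.2
        exact slopeRatio_eq_of_speedDropDeriv_eq_zero h0 tc
          (kineticEnergy_pos_of_mem h0 h (Set.Ioo_subset_Icc_self t1))
          (kineticEnergy_pos_of_le_pi h0 h t2 (exitAngle_le_pi γ t)) (by linarith)
          (sin_gt_of_mem h0 h t2 (exitAngle_lt h0 h tc.le)).ne' t0
    refine slopeRatio_not_eq_twice h0 huv ?_ (hratio u u1 su u2 hu0) (hratio v v1 sv v2 hv0)
    intro w hw
    obtain ⟨w1, w2⟩ := hint x hx y hy w ⟨hu.1.trans_le hw.1, hw.2.trans_lt hv.2⟩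
    have wc := cos_lt_of_mem h0 h w1.1 w1.2
    have ws := sin_neg_of_Icc (by linarith [u1.1]) (by linarith [v1.2]) su hw
    have we := exitAngle_lt h0 h wc.le
    exact ⟨wc, ws, (sin_gt_of_mem h0 h w2 we).ne',
      ((slopeRate_lt_one h0 h w1 ws).trans (one_lt_slopeRate h0 h w2 we)).ne⟩

lemma eq_of_hasDerivAt_zero {D : Set ℝ} (hD : Convex ℝ D) {f : ℝ → ℝ} (hf : ContinuousOn f D)
    (h : ∀ x ∈ interior D, HasDerivAt f 0 x) {x y : ℝ} (hx : x ∈ D) (hy : y ∈ D) : f x = f y := by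
  have hd : DifferentiableOn ℝ f (interior D) :=
    fun x hx => (h x hx).differentiableAt.differentiableWithinAt
  have h1 := monotoneOn_of_deriv_nonneg hD hf hd fun x hx => (h x hx).deriv.ge
  have h2 := antitoneOn_of_deriv_nonpos hD hf hd fun x hx => (h x hx).deriv.le
  rcases le_total x y with hxy | hxy
  · exact le_antisymm (h1 hx hy hxy) (h2 hx hy hxy)
  · exact le_antisymm (h2 hy hx hxy) (h1 hy hx hxy)

lemma hasDerivAt_sq_div_two_sub_kineticEnergy {γ x : ℝ} {φ ψ : ℝ → ℝ}
    (h1 : HasDerivAt φ (ψ x) x) (h2 : HasDerivAt ψ (Real.sin (φ x) - γ) x) :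
    HasDerivAt (fun t => ψ t ^ 2 / 2 - kineticEnergy γ (φ t)) 0 x := by
  have h3 := ((h2.pow 2).div_const 2).sub ((hasDerivAt_kineticEnergy γ (φ x)).comp x h1)
  refine h3.congr_deriv ?_
  simp
  ring

namespace IsPinnedFluxon

variable {L γ : ℝ} {φ : ℝ → ℝ}

lemma hasDerivAt {d : ℝ} (hφ : IsPinnedFluxon L d γ φ) (x : ℝ) : HasDerivAt φ (deriv φ x) x :=
  (hφ.1.differentiable (by simp)).differentiableAt.hasDerivAt

lemma continuous_deriv {d : ℝ} (hφ : IsPinnedFluxon L d γ φ) : Continuous (deriv φ) :=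
  hφ.1.continuous_deriv (by simp)

lemma hasDerivAt_deriv_of_lt {d : ℝ} (hL : 0 < L) (hφ : IsPinnedFluxon L d γ φ) {x : ℝ}
    (hx : L < |x|) : HasDerivAt (deriv φ) (Real.sin (φ x) - γ) x := by
  obtain ⟨c, hc, he⟩ := hφ.2.1 x
    (by rintro rfl; rw [abs_neg, abs_of_pos hL] at hx; exact hx.false)
    (by rintro rfl; rw [abs_of_pos hL] at hx; exact hx.false)
  rw [Dfun, if_neg hx.not_gt] at he
  rwa [show Real.sin (φ x) - γ = c by linarith]

lemma hasDerivAt_deriv_of_gt (hφ : IsPinnedFluxon L 0 γ φ) {x : ℝ} (hx : |x| < L) :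
    HasDerivAt (deriv φ) (-γ) x := by
  obtain ⟨h1, h2⟩ := abs_lt.1 hx
  obtain ⟨c, hc, he⟩ := hφ.2.1 x h1.ne' h2.ne
  rw [Dfun, if_pos hx] at he
  rwa [show -γ = c by linarith]

lemma sq_deriv_left {d : ℝ} (hL : 0 < L) (hφ : IsPinnedFluxon L d γ φ) {x : ℝ} (hx : x ≤ -L) :
    deriv φ x ^ 2 / 2 = kineticEnergy γ (φ x) := by
  set E : ℝ → ℝ := fun t => deriv φ t ^ 2 / 2 - kineticEnergy γ (φ t) with hE
  have hc : Continuous E :=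
    ((hφ.continuous_deriv.pow 2).div_const 2).sub
      ((continuous_kineticEnergy γ).comp hφ.1.continuous)
  have hconst : ∀ y ≤ -L, E y = E x := fun y hy =>
    eq_of_hasDerivAt_zero (convex_Iic (-L)) hc.continuousOn (fun z hz => by
      rw [interior_Iic] at hz
      exact hasDerivAt_sq_div_two_sub_kineticEnergy (hφ.hasDerivAt z)
        (hφ.hasDerivAt_deriv_of_lt hL (lt_abs.2 (Or.inr (by linarith [Set.mem_Iio.1 hz]))))) hy hx
  have hlim : Tendsto E atBot (𝓝 (0 ^ 2 / 2 - kineticEnergy γ (Real.arcsin γ))) :=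
    ((hφ.2.2.2.2.1.pow 2).div_const 2).sub
      (((continuous_kineticEnergy γ).tendsto _).comp hφ.2.2.1)
  rw [kineticEnergy_arcsin] at hlim
  have h0 : Tendsto E atBot (𝓝 (E x)) := tendsto_const_nhds.congr' (by
    filter_upwards [eventually_le_atBot (-L)] with y hy using (hconst y hy).symm)
  have := tendsto_nhds_unique hlim h0
  simp only [hE] at this
  linarith

lemma sq_deriv_right {d : ℝ} (hL : 0 < L) (hφ : IsPinnedFluxon L d γ φ) {x : ℝ} (hx : L ≤ x) :
    deriv φ x ^ 2 / 2 = kineticEnergy γ (φ x - 2 * π) := by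
  set E : ℝ → ℝ := fun t => deriv φ t ^ 2 / 2 - kineticEnergy γ (φ t - 2 * π) with hE
  have hc : Continuous E := ((hφ.continuous_deriv.pow 2).div_const 2).sub
    ((continuous_kineticEnergy γ).comp (hφ.1.continuous.sub continuous_const))
  have hconst : ∀ y, L ≤ y → E y = E x := fun y hy =>
    eq_of_hasDerivAt_zero (convex_Ici L) hc.continuousOn (fun z hz => by
      rw [interior_Ici] at hz
      refine hasDerivAt_sq_div_two_sub_kineticEnergy ((hφ.hasDerivAt z).sub_const (2 * π)) ?_
      rw [Real.sin_sub_two_pi]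
      exact hφ.hasDerivAt_deriv_of_lt hL (lt_abs.2 (Or.inl hz))) hy hx
  have hlim : Tendsto E atTop (𝓝 (0 ^ 2 / 2 - kineticEnergy γ (Real.arcsin γ + 2 * π - 2 * π))) :=
    ((hφ.2.2.2.2.2.pow 2).div_const 2).sub
      (((continuous_kineticEnergy γ).tendsto _).comp (hφ.2.2.2.1.sub_const _))
  rw [add_sub_cancel_right, kineticEnergy_arcsin] at hlim
  have h0 : Tendsto E atTop (𝓝 (E x)) := tendsto_const_nhds.congr' (by
    filter_upwards [eventually_ge_atTop L] with y hy using (hconst y hy).symm)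
  have := tendsto_nhds_unique hlim h0
  simp only [hE] at this
  linarith

lemma deriv_middle (hφ : IsPinnedFluxon L 0 γ φ) {x : ℝ} (hx : x ∈ Set.Icc (-L) L) :
    deriv φ x = deriv φ (-L) - γ * (x + L) := by
  have hc : Continuous fun t => deriv φ t + γ * t :=
    hφ.continuous_deriv.add (continuous_const.mul continuous_id)
  have := eq_of_hasDerivAt_zero (convex_Icc (-L) L) hc.continuousOn (fun z hz => by
    rw [interior_Icc] at hz
    have := (hφ.hasDerivAt_deriv_of_gt (abs_lt.2 hz)).add ((hasDerivAt_id z).const_mul γ)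
    exact this.congr_deriv (by simp)) hx (Set.left_mem_Icc.2 (hx.1.trans hx.2))
  linarith

lemma apply_right (hL : 0 < L) (hφ : IsPinnedFluxon L 0 γ φ) :
    φ L = φ (-L) + 2 * L * deriv φ (-L) - 2 * γ * L ^ 2 := by
  have hc : Continuous fun t => φ t - deriv φ (-L) * t + γ * (t + L) ^ 2 / 2 := by
    have := hφ.1.continuous
    fun_prop
  have := eq_of_hasDerivAt_zero (convex_Icc (-L) L) hc.continuousOn (fun z hz => by
    rw [interior_Icc] at hz
    have := ((hφ.hasDerivAt z).sub ((hasDerivAt_id z).const_mul (deriv φ (-L)))).add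
      (((((hasDerivAt_id z).add_const L).pow 2).const_mul γ).div_const 2)
    refine this.congr_deriv ?_
    rw [hφ.deriv_middle ⟨hz.1.le, hz.2.le⟩]
    simp
    ring) (Set.right_mem_Icc.2 (by linarith : -L ≤ L)) (Set.left_mem_Icc.2 (by linarith))
  nlinarith

lemma deriv_right (hL : 0 < L) (hφ : IsPinnedFluxon L 0 γ φ) :
    deriv φ L = deriv φ (-L) - 2 * γ * L := by
  rw [hφ.deriv_middle (Set.right_mem_Icc.2 (by linarith : -L ≤ L))]
  ring

lemma apply_right_sub (hL : 0 < L) (hφ : IsPinnedFluxon L 0 γ φ) :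
    φ L - φ (-L) = L * (deriv φ (-L) + deriv φ L) := by
  rw [hφ.deriv_right hL, hφ.apply_right hL]
  ring

lemma cos_apply_right (hL : 0 < L) (hφ : IsPinnedFluxon L 0 γ φ) :
    Real.cos (φ L) = Real.cos (φ (-L)) + 2 * π * γ := by
  have h1 := hφ.sq_deriv_left hL le_rfl
  have h2 := hφ.sq_deriv_right hL le_rfl
  have h3 := hφ.apply_right hL
  rw [hφ.deriv_right hL] at h2
  simp only [kineticEnergy, Real.cos_sub_two_pi] at h1 h2
  rw [h3] at h2 ⊢
  linarith

lemma le_inv_pi (hL : 0 < L) (hφ : IsPinnedFluxon L 0 γ φ) : γ ≤ 1 / π := by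
  have := hφ.cos_apply_right hL
  rw [le_div_iff₀ Real.pi_pos]
  linarith [Real.cos_le_one (φ L), Real.neg_one_le_cos (φ (-L))]

end IsPinnedFluxon

lemma eq_zero_of_abs_deriv_le {D : Set ℝ} (hD : Convex ℝ D) {E E' : ℝ → ℝ} (hE : ContinuousOn E D)
    (h0 : ∀ x, 0 ≤ E x) (hd : ∀ x ∈ interior D, HasDerivAt E (E' x) x)
    (hb : ∀ x ∈ interior D, |E' x| ≤ 2 * E x) {c x : ℝ} (hc : c ∈ D) (hx : x ∈ D)
    (hEc : E c = 0) : E x = 0 := by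
  have hexp : ∀ k y : ℝ, HasDerivAt (fun t => Real.exp (k * t)) (Real.exp (k * y) * k) y := by
    intro k y
    have := ((hasDerivAt_id y).const_mul k).exp
    simpa using this
  have hprod : ∀ k : ℝ, ∀ y ∈ interior D, HasDerivAt (fun t => E t * Real.exp (k * t))
      ((E' y + k * E y) * Real.exp (k * y)) y := fun k y hy =>
    ((hd y hy).mul (hexp k y)).congr_deriv (by ring)
  have hcont : ∀ k : ℝ, ContinuousOn (fun t => E t * Real.exp (k * t)) D := fun k =>
    hE.mul (by fun_prop)
  refine le_antisymm ?_ (h0 x)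
  rcases le_total c x with hcx | hcx
  · have := antitoneOn_of_deriv_nonpos hD (hcont (-2))
      (fun y hy => (hprod (-2) y hy).differentiableAt.differentiableWithinAt)
      (fun y hy => by
        rw [(hprod (-2) y hy).deriv]
        exact mul_nonpos_of_nonpos_of_nonneg (by linarith [(abs_le.1 (hb y hy)).2])
          (Real.exp_pos _).le) hc hx hcx
    simp only [hEc, zero_mul] at this
    exact nonpos_of_mul_nonpos_left this (Real.exp_pos _)
  · have := monotoneOn_of_deriv_nonneg hD (hcont 2)
      (fun y hy => (hprod 2 y hy).differentiableAt.differentiableWithinAt)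
      (fun y hy => by
        rw [(hprod 2 y hy).deriv]
        exact mul_nonneg (by linarith [(abs_le.1 (hb y hy)).1])
          (Real.exp_pos _).le) hx hc hcx
    simp only [hEc, zero_mul] at this
    exact nonpos_of_mul_nonpos_left this (Real.exp_pos _)

namespace IsPinnedFluxon

variable {L γ : ℝ} {φ ψ : ℝ → ℝ}

lemma ext_of_eq (hL : 0 < L) (hφ : IsPinnedFluxon L 0 γ φ) (hψ : IsPinnedFluxon L 0 γ ψ)
    (h0 : φ (-L) = ψ (-L)) (h1 : deriv φ (-L) = deriv ψ (-L)) : φ = ψ := by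
  set E : ℝ → ℝ := fun t => (φ t - ψ t) ^ 2 + (deriv φ t - deriv ψ t) ^ 2 with hE
  have hcont : Continuous E := ((hφ.1.continuous.sub hψ.1.continuous).pow 2).add
    ((hφ.continuous_deriv.sub hψ.continuous_deriv).pow 2)
  have hnonneg : ∀ x, 0 ≤ E x := fun x => by positivity
  have hderiv : ∀ x p q, HasDerivAt (deriv φ) p x → HasDerivAt (deriv ψ) q x → HasDerivAt E
      (2 * (φ x - ψ x) * (deriv φ x - deriv ψ x) + 2 * (deriv φ x - deriv ψ x) * (p - q)) x := by
    intro x p q hp hq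
    have := (((hφ.hasDerivAt x).sub (hψ.hasDerivAt x)).pow 2).add ((hp.sub hq).pow 2)
    exact this.congr_deriv (by simp)
  have hbound : ∀ x r : ℝ, |r| ≤ |φ x - ψ x| → |2 * (φ x - ψ x) * (deriv φ x - deriv ψ x) +
      2 * (deriv φ x - deriv ψ x) * r| ≤ 2 * E x := by
    intro x r hr
    refine (abs_add_le _ _).trans ?_
    simp only [abs_mul, abs_two, hE]
    rw [← sq_abs (φ x - ψ x), ← sq_abs (deriv φ x - deriv ψ x)]
    nlinarith [sq_nonneg (|φ x - ψ x| - |deriv φ x - deriv ψ x|),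
      mul_le_mul_of_nonneg_left hr (abs_nonneg (deriv φ x - deriv ψ x))]
  have hout : ∀ D : Set ℝ, Convex ℝ D → (∀ x ∈ interior D, L < |x|) → ∀ c ∈ D, E c = 0 →
      ∀ x ∈ D, E x = 0 := by
    intro D hD hDL c hc hEc x hx
    exact eq_zero_of_abs_deriv_le hD hcont.continuousOn hnonneg
      (fun y hy => hderiv y _ _ (hφ.hasDerivAt_deriv_of_lt hL (hDL y hy))
        (hψ.hasDerivAt_deriv_of_lt hL (hDL y hy)))
      (fun y _ => hbound y _ (by
        rw [sub_sub_sub_cancel_right]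
        exact Real.abs_sin_sub_sin_le _ _)) hc hx hEc
  have hEL : E (-L) = 0 := by simp [hE, h0, h1]
  have hmid : ∀ x ∈ Set.Icc (-L) L, E x = 0 := fun x hx =>
    eq_zero_of_abs_deriv_le (convex_Icc (-L) L) hcont.continuousOn hnonneg
      (fun y hy => by
        rw [interior_Icc] at hy
        exact hderiv y _ _ (hφ.hasDerivAt_deriv_of_gt (abs_lt.2 hy))
          (hψ.hasDerivAt_deriv_of_gt (abs_lt.2 hy)))
      (fun y _ => hbound y _ (by simp)) (Set.left_mem_Icc.2 (by linarith)) hx hEL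
  have hall : ∀ x, E x = 0 := by
    intro x
    rcases le_total x (-L) with hx | hx
    · exact hout (Set.Iic (-L)) (convex_Iic _) (fun y hy => by
        rw [interior_Iic] at hy
        exact lt_abs.2 (Or.inr (by linarith [Set.mem_Iio.1 hy]))) (-L) Set.self_mem_Iic hEL x hx
    · rcases le_total x L with hx' | hx'
      · exact hmid x ⟨hx, hx'⟩
      · exact hout (Set.Ici L) (convex_Ici _) (fun y hy => by
          rw [interior_Ici] at hy
          exact lt_abs.2 (Or.inl hy)) L Set.self_mem_Ici
          (hmid L (Set.right_mem_Icc.2 (by linarith))) x hx'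
  ext x
  have := hall x
  simp only [hE] at this
  nlinarith [sq_nonneg (φ x - ψ x), sq_nonneg (deriv φ x - deriv ψ x)]

end IsPinnedFluxon

/-- The largest half-length of the inhomogeneity in the existence theorem. -/
noncomputable def maxHalfLength (γ : ℝ) : ℝ :=
  (Real.sqrt (2 * (saddleEnergy γ - 1 + γ * minAngle γ)) - Real.sqrt (2 * (saddleEnergy γ - 1))) /
    (2 * γ)

lemma exists_critical_point_of_tendsto {f f' : ℝ → ℝ} {c A : ℝ} (hf : ∀ x, HasDerivAt f (f' x) x)
    (hc : f c < A) (hc' : f' c < 0) (hA : Tendsto f atTop (𝓝 A)) :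
    ∃ m, c < m ∧ f m < A ∧ f' m = 0 := by
  obtain ⟨X, hX, hcX⟩ := ((hA.eventually_const_lt hc).and (eventually_gt_atTop c)).exists
  have hcont : Continuous f := continuous_iff_continuousAt.2 fun x => (hf x).continuousAt
  obtain ⟨m, hm, hmin⟩ := isCompact_Icc.exists_isMinOn (Set.nonempty_Icc.2 hcX.le)
    hcont.continuousOn
  have hmc : f m ≤ f c := hmin (Set.left_mem_Icc.2 hcX.le)
  have hcm : c < m := by
    refine lt_of_le_of_ne hm.1 ?_
    rintro rfl
    have := hmin.localize.hasFDerivWithinAt_nonneg (hf c).hasFDerivAt.hasFDerivWithinAt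
      (y := X - c) (mem_posTangentConeAt_of_segment_subset (by
        rw [add_sub_cancel, segment_eq_Icc hcX.le]))
    simp at this
    nlinarith
  have hmX : m < X := by
    refine lt_of_le_of_ne hm.2 ?_
    rintro rfl
    linarith
  exact ⟨m, hcm, hmc.trans_lt hc,
    (hmin.isLocalMin (Icc_mem_nhds hcm hmX)).hasDerivAt_eq_zero (hf m)⟩

namespace IsPinnedFluxon

variable {L γ : ℝ} {φ : ℝ → ℝ}

lemma lt_two_pi_left {d : ℝ} (h0 : 0 < γ) (hL : 0 < L) (hφ : IsPinnedFluxon L d γ φ) {x : ℝ}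
    (hx : x ≤ -L) : φ x < 2 * π := by
  by_contra! hc
  have ha : Real.arcsin γ < 2 * π := by linarith [Real.arcsin_le_pi_div_two γ, Real.pi_pos]
  obtain ⟨y, hy, hyx⟩ := ((hφ.2.2.1.eventually_lt_const ha).and (eventually_le_atBot x)).exists
  obtain ⟨z, hz, hz2⟩ := intermediate_value_Icc hyx hφ.1.continuous.continuousOn ⟨hy.le, hc⟩
  have := hφ.sq_deriv_left hL (hz.2.trans hx)
  rw [hz2] at this
  linarith [kineticEnergy_two_pi_neg h0, sq_nonneg (deriv φ z)]

lemma lt_four_pi_right {d : ℝ} (h0 : 0 < γ) (hL : 0 < L) (hφ : IsPinnedFluxon L d γ φ) {x : ℝ}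
    (hx : L ≤ x) : φ x < 4 * π := by
  by_contra! hc
  have ha : Real.arcsin γ + 2 * π < 4 * π := by
    linarith [Real.arcsin_le_pi_div_two γ, Real.pi_pos]
  obtain ⟨y, hy, hyx⟩ := ((hφ.2.2.2.1.eventually_lt_const ha).and (eventually_ge_atTop x)).exists
  obtain ⟨z, hz, hz2⟩ := intermediate_value_Icc' hyx hφ.1.continuous.continuousOn ⟨hy.le, hc⟩
  have := hφ.sq_deriv_right hL (hx.trans hz.1)
  rw [hz2, show 4 * π - 2 * π = 2 * π by ring] at this
  linarith [kineticEnergy_two_pi_neg h0, sq_nonneg (deriv φ z)]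

lemma le_apply_of_deriv_nonpos {d : ℝ} (h0 : 0 < γ) (h : γ ≤ 1 / π) (hL : 0 < L)
    (hφ : IsPinnedFluxon L d γ φ) (hp : deriv φ L ≤ 0) : Real.arcsin γ + 2 * π ≤ φ L := by
  by_contra! hc
  have hlt : deriv φ L < 0 := by
    refine lt_of_le_of_ne hp fun h' => ?_
    have h1 := hφ.sq_deriv_right hL le_rfl
    have h2 := kineticEnergy_pos_of_lt h0 h (u := φ L - 2 * π) (by linarith)
    rw [← h1, h'] at h2
    norm_num at h2
  obtain ⟨m, hm, hmA, hm0⟩ := exists_critical_point_of_tendsto hφ.hasDerivAt hc hlt hφ.2.2.2.1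
  have h1 := hφ.sq_deriv_right hL hm.le
  have h2 := kineticEnergy_pos_of_lt h0 h (u := φ m - 2 * π) (by linarith)
  rw [← h1, hm0] at h2
  norm_num at h2

lemma deriv_left_pos (h0 : 0 < γ) (h : γ ≤ 1 / π) (hL : 0 < L)
    (hφ : IsPinnedFluxon L 0 γ φ) : 0 < deriv φ (-L) := by
  by_contra! hc
  have h1 := hφ.deriv_right hL
  have h2 : deriv φ L < 0 := by nlinarith [mul_pos h0 hL]
  have h3 := hφ.le_apply_of_deriv_nonpos h0 h hL h2.le
  have h4 := hφ.lt_two_pi_left h0 hL le_rfl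
  have h5 := hφ.apply_right_sub hL
  nlinarith [Real.arcsin_pos.2 h0]

lemma arcsin_le_apply_left {d : ℝ} (h0 : 0 < γ) (h : γ ≤ 1 / π) (hL : 0 < L)
    (hφ : IsPinnedFluxon L d γ φ) (hp : 0 < deriv φ (-L)) : Real.arcsin γ ≤ φ (-L) := by
  by_contra! hc
  have hd : ∀ x, HasDerivAt (fun t => φ (-t)) (-deriv φ (-x)) x := by
    intro x
    have := (hφ.hasDerivAt (-x)).comp x (hasDerivAt_neg x)
    exact this.congr_deriv (by simp)
  obtain ⟨m, hm, hmA, hm0⟩ := exists_critical_point_of_tendsto hd hc (by linarith)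
    (hφ.2.2.1.comp tendsto_neg_atTop_atBot)
  have h1 := hφ.sq_deriv_left hL (neg_le_neg hm.le)
  have h2 := kineticEnergy_pos_of_lt h0 h hmA
  rw [← h1, neg_eq_zero.1 hm0] at h2
  norm_num at h2

lemma apply_left_mem (h0 : 0 < γ) (h : γ ≤ 1 / π) (hL : 0 < L) (hφ : IsPinnedFluxon L 0 γ φ) :
    φ (-L) ∈ Set.Icc (minAngle γ) (2 * π - minAngle γ) := by
  have h1 := hφ.arcsin_le_apply_left h0 h hL (hφ.deriv_left_pos h0 h hL)
  refine mem_of_cos_le ((Real.arcsin_pos.2 h0).le.trans h1) (hφ.lt_two_pi_left h0 hL le_rfl).le ?_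
  linarith [hφ.cos_apply_right hL, Real.cos_le_one (φ L)]

lemma deriv_left (h0 : 0 < γ) (h : γ ≤ 1 / π) (hL : 0 < L) (hφ : IsPinnedFluxon L 0 γ φ) :
    deriv φ (-L) = Real.sqrt (2 * kineticEnergy γ (φ (-L))) := by
  rw [← hφ.sq_deriv_left hL le_rfl, mul_div_cancel₀ _ two_ne_zero,
    Real.sqrt_sq (hφ.deriv_left_pos h0 h hL).le]

lemma injOn_apply_left (h0 : 0 < γ) (h : γ ≤ 1 / π) (hL : 0 < L) :
    Set.InjOn (fun φ : ℝ → ℝ => φ (-L)) {φ | IsPinnedFluxon L 0 γ φ} := by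
  intro φ hφ ψ hψ he
  refine ext_of_eq hL hφ hψ he ?_
  rw [hφ.deriv_left h0 h hL, hψ.deriv_left h0 h hL]
  exact congrArg (fun u => Real.sqrt (2 * kineticEnergy γ u)) he

lemma sqrt_le_deriv_right (h0 : 0 < γ) (h : γ ≤ 1 / π) (hL : 0 < L) (hL' : L ≤ maxHalfLength γ)
    (hφ : IsPinnedFluxon L 0 γ φ) : Real.sqrt (2 * (saddleEnergy γ - 1)) ≤ deriv φ L := by
  have h1 := le_kineticEnergy_of_mem h0 h (hφ.apply_left_mem h0 h hL)
  have h2 : Real.sqrt (2 * (saddleEnergy γ - 1 + γ * minAngle γ)) ≤ deriv φ (-L) := by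
    rw [hφ.deriv_left h0 h hL]
    exact Real.sqrt_le_sqrt (by linarith)
  rw [maxHalfLength, le_div_iff₀ (by positivity)] at hL'
  rw [hφ.deriv_right hL]
  linarith

lemma apply_right_eq (h0 : 0 < γ) (h : γ ≤ 1 / π) (hL : 0 < L) (hL' : L ≤ maxHalfLength γ)
    (hφ : IsPinnedFluxon L 0 γ φ) :
    φ L = 2 * π - exitAngle γ (φ (-L)) ∨ φ L = 2 * π + exitAngle γ (φ (-L)) ∨
      φ L = 4 * π - exitAngle γ (φ (-L)) := by
  have hmem := hφ.apply_left_mem h0 h hL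
  have hp1 := hφ.deriv_left_pos h0 h hL
  have hp2 : 0 ≤ deriv φ L := (Real.sqrt_nonneg _).trans (hφ.sqrt_le_deriv_right h0 h hL hL')
  have hlt : φ (-L) < φ L := by
    have := hφ.apply_right_sub hL
    nlinarith [mul_pos hL hp1, mul_nonneg hL.le hp2]
  have hcos := hφ.cos_apply_right hL
  have hpos : 0 < φ (-L) := (minAngle_pos h0).trans_le hmem.1
  have h4 := hφ.lt_four_pi_right h0 hL le_rfl
  rw [exitAngle, ← hcos]
  rcases le_total (φ L) π with h1 | h1
  · exfalso
    have := Real.cos_le_cos_of_nonneg_of_le_pi hpos.le h1 hlt.le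
    nlinarith [Real.pi_pos]
  rcases le_total (φ L) (2 * π) with h2 | h2
  · left
    rw [← Real.cos_two_pi_sub, Real.arccos_cos (by linarith) (by linarith)]
    ring
  rcases le_total (φ L) (3 * π) with h3 | h3
  · right; left
    rw [← Real.cos_sub_two_pi, Real.arccos_cos (by linarith) (by linarith)]
    ring
  · right; right
    rw [← Real.cos_sub_two_pi, ← Real.cos_two_pi_sub, Real.arccos_cos (by linarith) (by linarith)]
    ring

lemma deriv_right_eq (h0 : 0 < γ) (h : γ ≤ 1 / π) (hL : 0 < L) (hL' : L ≤ maxHalfLength γ)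
    (hφ : IsPinnedFluxon L 0 γ φ) :
    0 < kineticEnergy γ (φ L - 2 * π) ∧
      deriv φ (-L) - Real.sqrt (2 * kineticEnergy γ (φ L - 2 * π)) = 2 * γ * L ∧
      saddleEnergy γ - 1 ≤ kineticEnergy γ (φ L - 2 * π) := by
  have h1 := one_lt_saddleEnergy h0 h
  have h2 := hφ.sqrt_le_deriv_right h0 h hL hL'
  have h3 : 0 < Real.sqrt (2 * (saddleEnergy γ - 1)) := Real.sqrt_pos.2 (by linarith)
  have h4 := Real.sq_sqrt (show 0 ≤ 2 * (saddleEnergy γ - 1) by linarith)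
  rw [← hφ.sq_deriv_right hL le_rfl, mul_div_cancel₀ _ two_ne_zero,
    Real.sqrt_sq (h3.le.trans h2), hφ.deriv_right hL, ← hφ.deriv_right hL]
  refine ⟨by have := h3.trans_le h2; positivity, by rw [hφ.deriv_right hL]; ring, by nlinarith⟩

lemma apply_left_mem_union (h0 : 0 < γ) (h : γ ≤ 1 / π) (hL : 0 < L)
    (hL' : L ≤ maxHalfLength γ) (hφ : IsPinnedFluxon L 0 γ φ) :
    φ (-L) ∈ {x ∈ {x ∈ Set.Icc (minAngle γ) (2 * π - minAngle γ) |
          0 < pendulumEnergy (-γ) (saddleEnergy γ - 0) (exitAngle γ x)} |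
        speedDrop γ (-γ) (saddleEnergy γ - 0) x = 2 * γ * L} ∪
      {x ∈ {x ∈ Set.Icc (minAngle γ) (2 * π - minAngle γ) |
          0 < pendulumEnergy (-γ) (saddleEnergy γ - 2 * π * γ) (exitAngle γ x)} |
        speedDrop γ (-γ) (saddleEnergy γ - 2 * π * γ) x = 2 * γ * L} ∪
      {x ∈ {x ∈ Set.Icc (minAngle γ) (2 * π - minAngle γ) | Real.arcsin γ < exitAngle γ x} |
        speedDrop γ γ (saddleEnergy γ) x = 2 * γ * L} := by
  have hmem := hφ.apply_left_mem h0 h hL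
  obtain ⟨hpos, hdrop, hge⟩ := hφ.deriv_right_eq h0 h hL hL'
  rw [hφ.deriv_left h0 h hL] at hdrop
  set θ := exitAngle γ (φ (-L)) with hθ
  have hθ0 : 0 ≤ θ := exitAngle_nonneg γ _
  rcases hφ.apply_right_eq h0 h hL hL' with he | he | he
  · have e : kineticEnergy γ (φ L - 2 * π) = pendulumEnergy (-γ) (saddleEnergy γ - 0) θ := by
      rw [he, kineticEnergy, pendulumEnergy, show 2 * π - θ - 2 * π = -θ by ring, Real.cos_neg]
      ring
    rw [e] at hpos hdrop
    exact Or.inl (Or.inl ⟨⟨hmem, hpos⟩, hdrop⟩)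
  · rw [he, add_sub_cancel_left] at hpos hdrop hge
    rcases lt_or_ge (Real.arcsin γ) θ with hlt | hle
    · exact Or.inr ⟨⟨hmem, hlt⟩, hdrop⟩
    · rcases hθ0.eq_or_lt with hz | hz
      · have e : kineticEnergy γ θ = pendulumEnergy (-γ) (saddleEnergy γ - 0) θ := by
          simp [kineticEnergy, pendulumEnergy, ← hz]
        rw [e] at hpos hdrop
        exact Or.inl (Or.inl ⟨⟨hmem, hpos⟩, hdrop⟩)
      · have h1 := kineticEnergy_strictAntiOn h0 h
          ⟨by linarith [Real.pi_pos], (Real.arcsin_pos.2 h0).le⟩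
          ⟨by linarith [Real.pi_pos], hle⟩ hz
        have h2 : kineticEnergy γ 0 = saddleEnergy γ - 1 := by simp [kineticEnergy]
        linarith
  · have e : kineticEnergy γ (φ L - 2 * π) =
        pendulumEnergy (-γ) (saddleEnergy γ - 2 * π * γ) θ := by
      rw [he, kineticEnergy, pendulumEnergy, show 4 * π - θ - 2 * π = 2 * π - θ by ring,
        Real.cos_two_pi_sub]
      ring
    rw [e] at hpos hdrop
    exact Or.inl (Or.inr ⟨⟨hmem, hpos⟩, hdrop⟩)

lemma encard_le_six (h0 : 0 < γ) (h : γ ≤ 1 / π) (hL : 0 < L) (hL' : L ≤ maxHalfLength γ) :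
    {φ : ℝ → ℝ | IsPinnedFluxon L 0 γ φ}.encard ≤ 6 := by
  rw [← (injOn_apply_left h0 h hL).encard_image]
  refine (Set.encard_le_encard
    (Set.image_subset_iff.2 fun φ hφ => apply_left_mem_union h0 h hL hL' hφ)).trans ?_
  refine (Set.encard_union_le _ _).trans ((add_le_add ((Set.encard_union_le _ _).trans
    (add_le_add (encard_speedDrop_neg_le_two h0 h le_rfl _)
      (encard_speedDrop_neg_le_two h0 h (by positivity) _)))
    (encard_speedDrop_le_two h0 h _)).trans ?_)
  norm_num

end IsPinnedFluxon

/-- The solution of `φ' = g φ` that leaves an equilibrium `a` and reaches `y` at time `0`. -/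
lemma exists_orbit {g : ℝ → ℝ} {a y b : ℝ} (hay : a < y) (hyb : y < b)
    (hg : ContinuousOn g (Set.Ioo a b)) (hpos : ∀ u ∈ Set.Ioo a b, 0 < g u)
    (hle : ∀ u ∈ Set.Ioo a b, g u ≤ u - a) :
    ∃ φ : ℝ → ℝ, φ 0 = y ∧ (∀ x ≤ 0, φ x ∈ Set.Ioo a b ∧ HasDerivAt φ (g (φ x)) x) ∧
      Tendsto φ atBot (𝓝 a) := by
  set T : ℝ → ℝ := fun z => ∫ u in y..z, (g u)⁻¹ with hT
  have hinv : ContinuousOn (fun u => (g u)⁻¹) (Set.Ioo a b) :=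
    hg.inv₀ fun u hu => (hpos u hu).ne'
  have hTd : ∀ z ∈ Set.Ioo a b, HasDerivAt T (g z)⁻¹ z := by
    intro z hz
    refine intervalIntegral.integral_hasDerivAt_right
      (hinv.mono (Set.OrdConnected.uIcc_subset Set.ordConnected_Ioo
        ⟨hay, hyb⟩ hz)).intervalIntegrable
      (hinv.stronglyMeasurableAtFilter isOpen_Ioo z hz) (hinv.continuousAt (Ioo_mem_nhds hz.1 hz.2))
  have hTc : ContinuousOn T (Set.Ioo a b) := fun z hz =>
    (hTd z hz).continuousAt.continuousWithinAt
  have hTmono : StrictMonoOn T (Set.Ioo a b) := by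
    refine strictMonoOn_of_deriv_pos (convex_Ioo a b) hTc fun z hz => ?_
    rw [interior_Ioo] at hz
    rw [(hTd z hz).deriv]
    exact inv_pos.2 (hpos z hz)
  have hTy : T y = 0 := intervalIntegral.integral_same
  have hTlog : ∀ z ∈ Set.Ioo a b, z ≤ y → T z ≤ Real.log (z - a) - Real.log (y - a) := by
    have hd : ∀ z ∈ Set.Ioo a b,
        HasDerivAt (fun t => T t - Real.log (t - a)) ((g z)⁻¹ - 1 / (z - a)) z := fun z hz =>
      (hTd z hz).sub (((hasDerivAt_id z).sub_const a).log (sub_ne_zero.2 hz.1.ne'))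
    have hm : MonotoneOn (fun t => T t - Real.log (t - a)) (Set.Ioo a b) := by
      refine monotoneOn_of_deriv_nonneg (convex_Ioo a b)
        (fun z hz => (hd z hz).continuousAt.continuousWithinAt)
        (fun z hz => ((hd z (interior_subset hz)).differentiableAt.differentiableWithinAt))
        fun z hz => ?_
      rw [interior_Ioo] at hz
      rw [(hd z hz).deriv, one_div]
      exact sub_nonneg.2 (inv_anti₀ (hpos z hz) (hle z hz))
    intro z hz hzy
    have := hm hz ⟨hay, hyb⟩ hzy
    simp only [hTy] at this
    linarith
  obtain ⟨y', hyy', hy'b⟩ := exists_between hyb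
  have hε : 0 < T y' := hTy ▸ hTmono ⟨hay, hyb⟩ ⟨hay.trans hyy', hy'b⟩ hyy'
  have hsub : ∀ z ∈ Set.Ioo a y', z ∈ Set.Ioo a b := fun z hz => ⟨hz.1, hz.2.trans hy'b⟩
  have hsurj : ∀ x < T y', ∃ z ∈ Set.Ioo a y', T z = x := by
    intro x hx
    have hlog : Tendsto (fun z => Real.log (z - a) - Real.log (y - a)) (𝓝[>] a) atBot := by
      refine tendsto_atBot_add_const_right _ _ (Real.tendsto_log_nhdsGT_zero.comp ?_)
      refine tendsto_nhdsWithin_iff.2 ⟨?_, ?_⟩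
      · have : Tendsto (fun z => z - a) (𝓝 a) (𝓝 (a - a)) := tendsto_id.sub_const a
        rw [sub_self] at this
        exact this.mono_left nhdsWithin_le_nhds
      · filter_upwards [self_mem_nhdsWithin] with z hz using
          Set.mem_Ioi.2 (sub_pos.2 (Set.mem_Ioi.1 hz))
    obtain ⟨z, hzx, haz, hzy⟩ := ((hlog.eventually_le_atBot x).and
      (Ioo_mem_nhdsGT hay)).exists
    have hzb : z ∈ Set.Ioo a b := ⟨haz, hzy.trans hyb⟩
    have hTz : T z ≤ x := (hTlog z hzb hzy.le).trans hzx
    have hzy' : z ≤ y' := (hzy.trans hyy').le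
    obtain ⟨w, hw, hwx⟩ := intermediate_value_Icc hzy'
      (hTc.mono fun u hu => ⟨haz.trans_le hu.1, hu.2.trans_lt hy'b⟩) ⟨hTz, hx.le⟩
    refine ⟨w, ⟨haz.trans_le hw.1, lt_of_le_of_ne hw.2 ?_⟩, hwx⟩
    rintro rfl
    exact hx.ne' hwx
  choose! φ hφmem hφT using hsurj
  have hleft : ∀ z ∈ Set.Ioo a y', φ (T z) = z := by
    intro z hz
    have hz' : T z < T y' := hTmono (hsub z hz) ⟨hay.trans hyy', hy'b⟩ hz.2
    exact hTmono.injOn (hsub _ (hφmem _ hz')) (hsub z hz) (hφT _ hz')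
  have hφmono : StrictMonoOn φ (Set.Iio (T y')) := by
    intro s hs t ht hst
    refine (hTmono.lt_iff_lt (hsub _ (hφmem s hs)) (hsub _ (hφmem t ht))).1 ?_
    rwa [hφT s hs, hφT t ht]
  have hφd : ∀ x < T y', HasDerivAt φ (g (φ x)) x := by
    intro x hx
    have hc : ContinuousAt φ x := by
      refine hφmono.continuousAt_of_image_mem_nhds (Iio_mem_nhds hx) ?_
      refine mem_of_superset (Ioo_mem_nhds (hφmem x hx).1 (hφmem x hx).2) fun z hz => ?_
      exact ⟨T z, hTmono (hsub z hz) ⟨hay.trans hyy', hy'b⟩ hz.2, hleft z hz⟩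
    have hm := hsub _ (hφmem x hx)
    have := HasDerivAt.of_local_left_inverse hc (hTd _ hm) (inv_ne_zero (hpos _ hm).ne')
      (by filter_upwards [Iio_mem_nhds hx] with t ht using hφT t ht)
    rwa [inv_inv] at this
  refine ⟨φ, ?_, fun x hx => ⟨hsub _ (hφmem x (hx.trans_lt hε)), hφd x (hx.trans_lt hε)⟩, ?_⟩
  · rw [← hTy]
    exact hleft y ⟨hay, hyy'⟩
  · refine tendsto_order.2 ⟨fun c hc => ?_, fun c hc => ?_⟩
    · filter_upwards [eventually_lt_atBot (T y')] with x hx using hc.trans (hφmem x hx).1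
    · obtain ⟨w, haw, hw⟩ := exists_between (lt_min hc (hay.trans hyy'))
      have hw' : w ∈ Set.Ioo a y' := ⟨haw, hw.trans_le (min_le_right _ _)⟩
      filter_upwards [eventually_lt_atBot (T y'), eventually_lt_atBot (T w)] with x hx hxw
      refine lt_trans ?_ (hw.trans_le (min_le_left _ _))
      refine (hTmono.lt_iff_lt (hsub _ (hφmem x hx)) (hsub w hw')).1 ?_
      rwa [hφT x hx]

lemma two_mul_kineticEnergy_le {γ : ℝ} (h0 : 0 < γ) (h : γ ≤ 1 / π) (u : ℝ) :
    2 * kineticEnergy γ u ≤ (u - Real.arcsin γ) ^ 2 := by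
  have hs := sin_arcsin_of_le_inv_pi h0 h
  set a := Real.arcsin γ
  have hd : ∀ v, HasDerivAt (fun t => (t - a) ^ 2 - 2 * kineticEnergy γ t)
      (2 * ((v - a) - (Real.sin v - Real.sin a))) v := by
    intro v
    have := (((hasDerivAt_id v).sub_const a).pow 2).sub
      ((hasDerivAt_kineticEnergy γ v).const_mul 2)
    refine this.congr_deriv ?_
    simp [hs]
    ring
  have hc : Continuous fun t => (t - a) ^ 2 - 2 * kineticEnergy γ t :=
    continuous_iff_continuousAt.2 fun v => (hd v).continuousAt
  have hz : (a - a) ^ 2 - 2 * kineticEnergy γ a = 0 := by rw [kineticEnergy_arcsin]; ring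
  rcases le_total a u with hu | hu
  · have := monotoneOn_of_deriv_nonneg (convex_Ici a) hc.continuousOn
      (fun v _ => (hd v).differentiableAt.differentiableWithinAt) (fun v hv => by
        rw [interior_Ici] at hv
        rw [(hd v).deriv]
        have h1 := (abs_le.1 (Real.abs_sin_sub_sin_le v a)).2
        rw [abs_of_pos (sub_pos.2 hv)] at h1
        linarith) Set.self_mem_Ici hu hu
    simp only [hz] at this
    linarith
  · have := antitoneOn_of_deriv_nonpos (convex_Iic a) hc.continuousOn
      (fun v _ => (hd v).differentiableAt.differentiableWithinAt) (fun v hv => by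
        rw [interior_Iic] at hv
        rw [(hd v).deriv]
        have h1 := (abs_le.1 (Real.abs_sin_sub_sin_le v a)).1
        rw [abs_of_neg (sub_neg.2 hv)] at h1
        linarith) hu Set.self_mem_Iic hu
    simp only [hz] at this
    linarith

lemma sqrt_two_mul_kineticEnergy_le {γ : ℝ} (h0 : 0 < γ) (h : γ ≤ 1 / π) (u : ℝ) :
    Real.sqrt (2 * kineticEnergy γ u) ≤ |u - Real.arcsin γ| := by
  rw [← Real.sqrt_sq_eq_abs]
  exact Real.sqrt_le_sqrt (two_mul_kineticEnergy_le h0 h u)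

lemma hasDerivAt_sqrt_kineticEnergy_comp {γ x : ℝ} {φ : ℝ → ℝ}
    (hpos : 0 < kineticEnergy γ (φ x))
    (hφ : HasDerivAt φ (Real.sqrt (2 * kineticEnergy γ (φ x))) x) :
    HasDerivAt (fun t => Real.sqrt (2 * kineticEnergy γ (φ t))) (Real.sin (φ x) - γ) x := by
  have := (((hasDerivAt_kineticEnergy γ (φ x)).comp x hφ).const_mul 2).sqrt
    (by simp only [Function.comp]; positivity)
  refine this.congr_deriv ?_
  have : Real.sqrt (2 * kineticEnergy γ (φ x)) ≠ 0 := (Real.sqrt_pos.2 (by positivity)).ne'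
  simp only [Function.comp]
  field_simp

lemma tendsto_sqrt_kineticEnergy_comp {γ : ℝ} {φ : ℝ → ℝ} {l : Filter ℝ}
    (hφ : Tendsto φ l (𝓝 (Real.arcsin γ))) :
    Tendsto (fun t => Real.sqrt (2 * kineticEnergy γ (φ t))) l (𝓝 0) := by
  have := (Real.continuous_sqrt.comp ((continuous_kineticEnergy γ).const_mul 2)).tendsto
    (Real.arcsin γ)
  simp only [Function.comp_apply, kineticEnergy_arcsin, mul_zero, Real.sqrt_zero] at this
  exact this.comp hφ

lemma exists_orbit_left {γ y : ℝ} (h0 : 0 < γ) (h : γ ≤ 1 / π) (hy : Real.arcsin γ < y)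
    (hpos : ∀ u, Real.arcsin γ < u → u ≤ y → 0 < kineticEnergy γ u) :
    ∃ φ ψ : ℝ → ℝ, φ 0 = y ∧ ψ 0 = Real.sqrt (2 * kineticEnergy γ y) ∧
      (∀ x ≤ 0, HasDerivAt φ (ψ x) x ∧ HasDerivAt ψ (Real.sin (φ x) - γ) x) ∧
      Tendsto φ atBot (𝓝 (Real.arcsin γ)) ∧ Tendsto ψ atBot (𝓝 0) := by
  obtain ⟨b, hyb, hb⟩ : ∃ b, y < b ∧ ∀ u ∈ Set.Ioo (Real.arcsin γ) b, 0 < kineticEnergy γ u := by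
    obtain ⟨b, hyb, hb⟩ := mem_nhdsGE_iff_exists_Ico_subset.1 (mem_nhdsWithin_of_mem_nhds
      ((continuous_kineticEnergy γ).continuousAt.eventually_const_lt (hpos y hy le_rfl)))
    refine ⟨b, hyb, fun u hu => ?_⟩
    rcases le_total u y with huy | huy
    · exact hpos u hu.1 huy
    · exact hb ⟨huy, hu.2⟩
  obtain ⟨φ, hφ0, hφ, hlim⟩ := exists_orbit (g := fun u => Real.sqrt (2 * kineticEnergy γ u))
    hy hyb (Real.continuous_sqrt.comp ((continuous_kineticEnergy γ).const_mul 2)).continuousOn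
    (fun u hu => Real.sqrt_pos.2 (mul_pos two_pos (hb u hu)))
    (fun u hu => (sqrt_two_mul_kineticEnergy_le h0 h u).trans
      (abs_of_pos (sub_pos.2 hu.1)).le)
  exact ⟨φ, fun t => Real.sqrt (2 * kineticEnergy γ (φ t)), hφ0, by simp only [hφ0],
    fun x hx => ⟨(hφ x hx).2, hasDerivAt_sqrt_kineticEnergy_comp (hb _ (hφ x hx).1) (hφ x hx).2⟩,
    hlim, tendsto_sqrt_kineticEnergy_comp hlim⟩

lemma exists_orbit_right {γ y : ℝ} (h0 : 0 < γ) (h : γ ≤ 1 / π) (hy : y < Real.arcsin γ) :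
    ∃ φ ψ : ℝ → ℝ, φ 0 = y ∧ ψ 0 = Real.sqrt (2 * kineticEnergy γ y) ∧
      (∀ x, 0 ≤ x → HasDerivAt φ (ψ x) x ∧ HasDerivAt ψ (Real.sin (φ x) - γ) x) ∧
      Tendsto φ atTop (𝓝 (Real.arcsin γ)) ∧ Tendsto ψ atTop (𝓝 0) := by
  obtain ⟨χ, hχ0, hχ, hlim⟩ := exists_orbit (g := fun u => Real.sqrt (2 * kineticEnergy γ (-u)))
    (neg_lt_neg hy) (lt_add_one (-y))
    (Real.continuous_sqrt.comp
      (((continuous_kineticEnergy γ).comp continuous_neg).const_mul 2)).continuousOn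
    (fun u hu => Real.sqrt_pos.2
      (mul_pos two_pos (kineticEnergy_pos_of_lt h0 h (by linarith [hu.1]))))
    (fun u hu => (sqrt_two_mul_kineticEnergy_le h0 h (-u)).trans
      (by rw [abs_of_neg (by linarith [hu.1])]; linarith))
  have hd : ∀ x, 0 ≤ x → HasDerivAt (fun t => -χ (-t))
      (Real.sqrt (2 * kineticEnergy γ (-χ (-x)))) x := by
    intro x hx
    have := ((hχ (-x) (by linarith)).2.comp x (hasDerivAt_neg x)).neg
    exact this.congr_deriv (by simp)
  have hlim' : Tendsto (fun t => -χ (-t)) atTop (𝓝 (Real.arcsin γ)) := by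
    have := (hlim.comp tendsto_neg_atTop_atBot).neg
    rwa [neg_neg] at this
  exact ⟨fun t => -χ (-t), fun t => Real.sqrt (2 * kineticEnergy γ (-χ (-t))), by simp [hχ0],
    by simp [hχ0],
    fun x hx => ⟨hd x hx, hasDerivAt_sqrt_kineticEnergy_comp (φ := fun t => -χ (-t))
      (kineticEnergy_pos_of_lt h0 h (by linarith [(hχ (-x) (by linarith)).1.1])) (hd x hx)⟩,
    hlim', tendsto_sqrt_kineticEnergy_comp hlim'⟩

lemma hasDerivAt_ite_le {f g f' g' : ℝ → ℝ} {c : ℝ} (hf : ∀ x ≤ c, HasDerivAt f (f' x) x)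
    (hg : ∀ x, c ≤ x → HasDerivAt g (g' x) x) (h : f c = g c) (h' : f' c = g' c) (x : ℝ) :
    HasDerivAt (fun t => if t ≤ c then f t else g t) (if x ≤ c then f' x else g' x) x := by
  rcases lt_trichotomy x c with hx | rfl | hx
  · rw [if_pos hx.le]
    refine (hf x hx.le).congr_of_eventuallyEq ?_
    filter_upwards [Iio_mem_nhds hx] with t ht using if_pos (Set.mem_Iio.1 ht).le
  · rw [if_pos le_rfl, ← hasDerivWithinAt_univ, ← Set.Iic_union_Ici (a := x)]
    refine HasDerivWithinAt.union ?_ ?_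
    · exact (hf x le_rfl).hasDerivWithinAt.congr (fun t ht => if_pos ht) (if_pos le_rfl)
    · rw [h']
      refine (hg x le_rfl).hasDerivWithinAt.congr (fun t ht => ?_) ?_
      · rcases (Set.mem_Ici.1 ht).eq_or_lt with rfl | ht'
        · rw [if_pos le_rfl, h]
        · exact if_neg ht'.not_ge
      · rw [if_pos le_rfl, h]
  · rw [if_neg hx.not_ge]
    refine (hg x hx.le).congr_of_eventuallyEq ?_
    filter_upwards [Ioi_mem_nhds hx] with t ht using if_neg (Set.mem_Ioi.1 ht).not_ge

lemma continuous_ite_le {f g : ℝ → ℝ} {c : ℝ} (hf : ∀ x ≤ c, ContinuousAt f x)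
    (hg : ∀ x, c ≤ x → ContinuousAt g x) (h : f c = g c) :
    Continuous fun t => if t ≤ c then f t else g t := by
  refine continuous_if_le continuous_id continuous_const
    (fun x hx => (hf x hx).continuousWithinAt) (fun x hx => (hg x hx).continuousWithinAt) ?_
  rintro x rfl
  exact h

/-- A fluxon is glued from orbits on the invariant manifolds of the two saddles and the parabola
connecting them across the inhomogeneity. -/
lemma exists_isPinnedFluxon_of_energy {γ L x y : ℝ} (h0 : 0 < γ) (h : γ ≤ 1 / π) (hL : 0 < L)
    (hx : Real.arcsin γ < x) (hy : y < Real.arcsin γ + 2 * π)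
    (hpos : ∀ u, Real.arcsin γ < u → u ≤ x → 0 < kineticEnergy γ u)
    (hcos : Real.cos y = Real.cos x + 2 * π * γ)
    (hdrop : Real.sqrt (2 * kineticEnergy γ x) - Real.sqrt (2 * kineticEnergy γ (y - 2 * π)) =
      2 * γ * L) : ∃ φ, IsPinnedFluxon L 0 γ φ ∧ φ (-L) = x := by
  obtain ⟨φ₁, ψ₁, hφ₁, hψ₁, hd₁, hl₁, hl₁'⟩ := exists_orbit_left h0 h hx hpos
  obtain ⟨φ₃, ψ₃, hφ₃, hψ₃, hd₃, hl₃, hl₃'⟩ :=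
    exists_orbit_right h0 h (y := y - 2 * π) (by linarith)
  set p := Real.sqrt (2 * kineticEnergy γ x) with hp
  set q := Real.sqrt (2 * kineticEnergy γ (y - 2 * π)) with hq
  have hp2 : p ^ 2 = 2 * kineticEnergy γ x := Real.sq_sqrt (by linarith [hpos x hx le_rfl])
  have hq2 : q ^ 2 = 2 * kineticEnergy γ (y - 2 * π) :=
    Real.sq_sqrt (by linarith [kineticEnergy_pos_of_lt h0 h (u := y - 2 * π) (by linarith)])
  have hyx : y = x + 2 * L * p - 2 * γ * L ^ 2 := by
    simp only [kineticEnergy, Real.cos_sub_two_pi] at hp2 hq2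
    have e1 : γ * (y - x) = γ * (2 * L * p - 2 * γ * L ^ 2) := by
      rw [show q = p - 2 * γ * L by linarith] at hq2
      linarith
    linarith [mul_left_cancel₀ h0.ne' e1]
  have hd₁' : ∀ t ≤ -L, HasDerivAt (fun t => φ₁ (t + L)) (ψ₁ (t + L)) t ∧
      HasDerivAt (fun t => ψ₁ (t + L)) (Real.sin (φ₁ (t + L)) - γ) t := fun t ht =>
    ⟨(hd₁ (t + L) (by linarith)).1.comp_add_const t L,
      (hd₁ (t + L) (by linarith)).2.comp_add_const t L⟩
  have hd₃' : ∀ t, L ≤ t → HasDerivAt (fun t => φ₃ (t - L) + 2 * π) (ψ₃ (t - L)) t ∧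
      HasDerivAt (fun t => ψ₃ (t - L)) (Real.sin (φ₃ (t - L) + 2 * π) - γ) t := fun t ht =>
    ⟨((hd₃ (t - L) (by linarith)).1.comp_sub_const t L).add_const _, by
      rw [Real.sin_add_two_pi]
      exact (hd₃ (t - L) (by linarith)).2.comp_sub_const t L⟩
  have hd₂ : ∀ t, HasDerivAt (fun t => x + p * (t + L) - γ * (t + L) ^ 2 / 2)
      (p - γ * (t + L)) t := by
    intro t
    have := ((((hasDerivAt_id t).add_const L).const_mul p).const_add x).sub
      (((((hasDerivAt_id t).add_const L).pow 2).const_mul γ).div_const 2)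
    refine this.congr_deriv ?_
    simp
    ring
  have hd₂' : ∀ t, HasDerivAt (fun t => p - γ * (t + L)) (-γ) t := by
    intro t
    have := (((hasDerivAt_id t).add_const L).const_mul γ).const_sub p
    exact this.congr_deriv (by simp)
  set φ₁₂ : ℝ → ℝ := fun t => if t ≤ -L then φ₁ (t + L) else x + p * (t + L) - γ * (t + L) ^ 2 / 2
    with hφ₁₂
  set ψ₁₂ : ℝ → ℝ := fun t => if t ≤ -L then ψ₁ (t + L) else p - γ * (t + L) with hψ₁₂
  have hd₁₂ : ∀ t, HasDerivAt φ₁₂ (ψ₁₂ t) t := hasDerivAt_ite_le (fun t ht => (hd₁' t ht).1)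
    (fun t _ => hd₂ t) (by simp [hφ₁]) (by simp [hψ₁])
  have hc₁₂ : Continuous ψ₁₂ := continuous_ite_le (fun t ht => (hd₁' t ht).2.continuousAt)
    (fun t _ => (hd₂' t).continuousAt) (by simp [hψ₁])
  have hLL : ¬ L ≤ -L := by linarith
  have hgφ : φ₁₂ L = φ₃ (L - L) + 2 * π := by
    simp only [hφ₁₂, if_neg hLL, sub_self, hφ₃]
    linarith
  have hgψ : ψ₁₂ L = ψ₃ (L - L) := by
    simp only [hψ₁₂, if_neg hLL, sub_self, hψ₃]
    linarith
  set φ : ℝ → ℝ := fun t => if t ≤ L then φ₁₂ t else φ₃ (t - L) + 2 * π with hφ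
  set ψ : ℝ → ℝ := fun t => if t ≤ L then ψ₁₂ t else ψ₃ (t - L) with hψ
  have hd : ∀ t, HasDerivAt φ (ψ t) t := hasDerivAt_ite_le (fun t _ => hd₁₂ t)
    (fun t ht => (hd₃' t ht).1) hgφ hgψ
  have hc : Continuous ψ := continuous_ite_le (fun t _ => hc₁₂.continuousAt)
    (fun t ht => (hd₃' t ht).2.continuousAt) hgψ
  have hderiv : deriv φ = ψ := funext fun t => (hd t).deriv
  have hleft : ∀ t ≤ -L, φ t = φ₁ (t + L) ∧ ψ t = ψ₁ (t + L) := fun t ht => by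
    simp only [hφ, hψ, hφ₁₂, hψ₁₂, if_pos (show t ≤ L by linarith), if_pos ht, and_self]
  have hmid : ∀ t, -L < t → t ≤ L → ψ t = p - γ * (t + L) := fun t ht ht' => by
    simp only [hψ, hψ₁₂, if_pos ht', if_neg ht.not_ge]
  have hright : ∀ t, L < t → φ t = φ₃ (t - L) + 2 * π ∧ ψ t = ψ₃ (t - L) := fun t ht => by
    simp only [hφ, hψ, if_neg ht.not_ge, and_self]
  refine ⟨φ, ⟨contDiff_one_iff_deriv.2 ⟨fun t => (hd t).differentiableAt, hderiv ▸ hc⟩, ?_, ?_, ?_,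
    ?_, ?_⟩, ?_⟩
  · intro t ht ht'
    rw [hderiv]
    rcases lt_or_gt_of_ne ht with ht | ht
    · refine ⟨Real.sin (φ t) - γ, ?_, ?_⟩
      · rw [(hleft t ht.le).1]
        refine (hd₁' t ht.le).2.congr_of_eventuallyEq ?_
        filter_upwards [Iio_mem_nhds ht] with s hs using (hleft s (Set.mem_Iio.1 hs).le).2
      · rw [Dfun, if_neg (not_lt.2 (le_abs.2 (Or.inr (by linarith))))]
        ring
    · rcases lt_or_gt_of_ne ht' with ht' | ht'
      · refine ⟨-γ, ?_, ?_⟩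
        · refine (hd₂' t).congr_of_eventuallyEq ?_
          filter_upwards [Ioo_mem_nhds ht ht'] with s hs using hmid s hs.1 hs.2.le
        · rw [Dfun, if_pos (abs_lt.2 ⟨ht, ht'⟩)]
          ring
      · refine ⟨Real.sin (φ t) - γ, ?_, ?_⟩
        · rw [(hright t ht').1]
          refine (hd₃' t ht'.le).2.congr_of_eventuallyEq ?_
          filter_upwards [Ioi_mem_nhds ht'] with s hs using (hright s hs).2
        · rw [Dfun, if_neg (not_lt.2 (le_abs.2 (Or.inl ht'.le)))]
          ring
  · refine (hl₁.comp (tendsto_atBot_add_const_right _ L tendsto_id)).congr' ?_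
    filter_upwards [eventually_le_atBot (-L)] with t ht using (hleft t ht).1.symm
  · refine ((hl₃.comp
      (tendsto_atTop_add_const_right _ (-L) tendsto_id)).add_const (2 * π)).congr' ?_
    filter_upwards [eventually_gt_atTop L] with t ht using (hright t ht).1.symm
  · rw [hderiv]
    refine (hl₁'.comp (tendsto_atBot_add_const_right _ L tendsto_id)).congr' ?_
    filter_upwards [eventually_le_atBot (-L)] with t ht using (hleft t ht).2.symm
  · rw [hderiv]
    refine (hl₃'.comp (tendsto_atTop_add_const_right _ (-L) tendsto_id)).congr' ?_
    filter_upwards [eventually_gt_atTop L] with t ht using (hright t ht).2.symm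
  · rw [(hleft (-L) le_rfl).1, neg_add_cancel, hφ₁]

lemma exists_isPinnedFluxon {γ L x : ℝ} (h0 : 0 < γ) (h : γ ≤ 1 / π) (hL : 0 < L)
    (hx : x ∈ Set.Icc (minAngle γ) (2 * π - minAngle γ))
    (hdrop : speedDrop γ (-γ) (saddleEnergy γ) x = 2 * γ * L) :
    ∃ φ, IsPinnedFluxon L 0 γ φ ∧ φ (-L) = x := by
  refine exists_isPinnedFluxon_of_energy h0 h hL ((arcsin_lt_minAngle h0 h).trans_le hx.1)
    (y := 2 * π - exitAngle γ x) ?_ (fun u => kineticEnergy_pos_of_mem_Ioc h0 h hx) ?_ ?_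
  · linarith [exitAngle_nonneg γ x, Real.arcsin_pos.2 h0]
  · rw [Real.cos_two_pi_sub, cos_exitAngle h0 (cos_le_of_mem h0 h hx.1 hx.2)]
  · rw [← hdrop, speedDrop, pendulumEnergy, kineticEnergy, kineticEnergy,
      show 2 * π - exitAngle γ x - 2 * π = -exitAngle γ x by ring, Real.cos_neg]
    ring_nf

/-- The smallest half-length of the inhomogeneity in the existence theorem. -/
noncomputable def minHalfLength (γ : ℝ) : ℝ :=
  (Real.sqrt (2 * (saddleEnergy γ + 1 - γ * π)) -
    Real.sqrt (2 * (saddleEnergy γ + 1 - γ * π - γ * minAngle γ))) / (2 * γ)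

lemma speedDrop_pi {γ : ℝ} (h0 : 0 < γ) (h : γ ≤ 1 / π) :
    speedDrop γ (-γ) (saddleEnergy γ) π = 2 * γ * minHalfLength γ := by
  have h1 : exitAngle γ π = π - minAngle γ := by
    rw [exitAngle, minAngle, Real.cos_pi, ← Real.arccos_neg]
    congr 1
    ring
  rw [minHalfLength, mul_div_cancel₀ _ (by positivity), speedDrop, h1, kineticEnergy,
    pendulumEnergy, Real.cos_pi_sub, cos_minAngle h0 h, Real.cos_pi]
  ring_nf

lemma exitAngle_eq_zero {γ x : ℝ} (hx : Real.cos x = 1 - 2 * π * γ) : exitAngle γ x = 0 := by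
  rw [exitAngle, hx, sub_add_cancel, Real.arccos_one]

lemma speedDrop_two_pi_sub_minAngle {γ : ℝ} (h0 : 0 < γ) (h : γ ≤ 1 / π) :
    speedDrop γ (-γ) (saddleEnergy γ) (2 * π - minAngle γ) = 2 * γ * maxHalfLength γ := by
  have hc : Real.cos (2 * π - minAngle γ) = 1 - 2 * π * γ := by
    rw [Real.cos_two_pi_sub, cos_minAngle h0 h]
  rw [maxHalfLength, mul_div_cancel₀ _ (by positivity), speedDrop, exitAngle_eq_zero hc,
    kineticEnergy, hc, pendulumEnergy, Real.cos_zero]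
  ring_nf

lemma le_speedDrop_minAngle {γ : ℝ} (h0 : 0 < γ) (h : γ ≤ 1 / π) :
    2 * γ * maxHalfLength γ ≤ speedDrop γ (-γ) (saddleEnergy γ) (minAngle γ) := by
  have hc := cos_minAngle h0 h
  rw [maxHalfLength, mul_div_cancel₀ _ (by positivity), speedDrop, exitAngle_eq_zero hc,
    kineticEnergy, hc, pendulumEnergy, Real.cos_zero, mul_zero, sub_zero]
  refine sub_le_sub_right (Real.sqrt_le_sqrt ?_) _
  nlinarith [mul_le_mul_of_nonneg_left (minAngle_le_pi γ) h0.le]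

lemma sqrt_sub_sqrt_eq_div {u v : ℝ} (hu : 0 < u) (hv : 0 ≤ v) :
    Real.sqrt u - Real.sqrt v = (u - v) / (Real.sqrt u + Real.sqrt v) := by
  have h1 := Real.sqrt_pos.2 hu
  rw [eq_div_iff (by positivity)]
  nlinarith [Real.sq_sqrt hu.le, Real.sq_sqrt hv]

lemma maxHalfLength_eq {γ : ℝ} (h0 : 0 < γ) (h : γ ≤ 1 / π) :
    maxHalfLength γ = minAngle γ / (Real.sqrt (2 * (saddleEnergy γ - 1 + γ * minAngle γ)) +
      Real.sqrt (2 * (saddleEnergy γ - 1))) := by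
  have h1 := one_lt_saddleEnergy h0 h
  have h2 := mul_pos h0 (minAngle_pos h0)
  rw [maxHalfLength, sqrt_sub_sqrt_eq_div (by linarith) (by linarith), div_right_comm]
  congr 1
  field_simp
  ring

lemma minHalfLength_eq {γ : ℝ} (h0 : 0 < γ) (h : γ ≤ 1 / π) :
    minHalfLength γ = minAngle γ / (Real.sqrt (2 * (saddleEnergy γ + 1 - γ * π)) +
      Real.sqrt (2 * (saddleEnergy γ + 1 - γ * π - γ * minAngle γ))) := by
  have h1 := one_lt_saddleEnergy h0 h
  have h2 := mul_pos h0 (minAngle_pos h0)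
  have h3 := pi_mul_le_one h
  have h4 := mul_le_mul_of_nonneg_left (minAngle_le_pi γ) h0.le
  rw [minHalfLength, sqrt_sub_sqrt_eq_div (by linarith) (by linarith), div_right_comm]
  congr 1
  field_simp
  ring

lemma sqrt_saddleEnergy_add_one_pos {γ : ℝ} (h0 : 0 < γ) (h : γ ≤ 1 / π) :
    1 ≤ Real.sqrt (2 * (saddleEnergy γ + 1 - γ * π)) := by
  have h1 := one_lt_saddleEnergy h0 h
  have h3 := pi_mul_le_one h
  exact Real.one_le_sqrt.2 (by linarith)

lemma minHalfLength_pos {γ : ℝ} (h0 : 0 < γ) (h : γ ≤ 1 / π) : 0 < minHalfLength γ := by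
  rw [minHalfLength_eq h0 h]
  have := sqrt_saddleEnergy_add_one_pos h0 h
  have := minAngle_pos h0
  positivity

lemma minHalfLength_le_minAngle {γ : ℝ} (h0 : 0 < γ) (h : γ ≤ 1 / π) :
    minHalfLength γ ≤ minAngle γ := by
  rw [minHalfLength_eq h0 h]
  exact div_le_self (minAngle_pos h0).le
    ((sqrt_saddleEnergy_add_one_pos h0 h).trans (le_add_of_nonneg_right (Real.sqrt_nonneg _)))

lemma minHalfLength_le_maxHalfLength {γ : ℝ} (h0 : 0 < γ) (h : γ ≤ 1 / π) :
    minHalfLength γ ≤ maxHalfLength γ := by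
  rw [minHalfLength_eq h0 h, maxHalfLength_eq h0 h]
  have h1 := one_lt_saddleEnergy h0 h
  have h2 := mul_pos h0 (minAngle_pos h0)
  have h3 := pi_mul_le_one h
  have h4 := mul_le_mul_of_nonneg_left (minAngle_le_pi γ) h0.le
  have h5 : 0 < Real.sqrt (2 * (saddleEnergy γ - 1 + γ * minAngle γ)) :=
    Real.sqrt_pos.2 (by linarith)
  exact div_le_div_of_nonneg_left (minAngle_pos h0).le (by positivity)
    (add_le_add (Real.sqrt_le_sqrt (by linarith)) (Real.sqrt_le_sqrt (by linarith)))

lemma le_sq_minAngle {γ : ℝ} (h0 : 0 < γ) (h : γ ≤ 1 / π) : 4 * γ ≤ minAngle γ ^ 2 := by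
  have h1 := Real.one_sub_sq_div_two_le_cos (x := minAngle γ)
  rw [cos_minAngle h0 h] at h1
  nlinarith [Real.pi_gt_three]

lemma le_maxHalfLength {γ : ℝ} (h0 : 0 < γ) (h : γ ≤ 1 / π) :
    (2 * Real.sqrt (minAngle γ))⁻¹ ≤ maxHalfLength γ := by
  rw [maxHalfLength_eq h0 h]
  have h1 := one_lt_saddleEnergy h0 h
  have hθ := minAngle_pos h0
  have h2 := mul_pos h0 hθ
  have h3 := Real.sqrt_pos.2 hθ
  have h4 := Real.sq_sqrt hθ.le
  have h5 : saddleEnergy γ - 1 ≤ γ * minAngle γ := by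
    have := mul_le_mul_of_nonneg_left (arcsin_lt_minAngle h0 h).le h0.le
    unfold saddleEnergy
    linarith [Real.cos_le_one (Real.arcsin γ)]
  have h6 : Real.sqrt (2 * (saddleEnergy γ - 1 + γ * minAngle γ)) ≤ Real.sqrt (minAngle γ) ^ 3 := by
    refine Real.sqrt_le_iff.2 ⟨by positivity, ?_⟩
    calc 2 * (saddleEnergy γ - 1 + γ * minAngle γ) ≤ 4 * γ * minAngle γ := by linarith
      _ ≤ minAngle γ ^ 2 * minAngle γ := mul_le_mul_of_nonneg_right (le_sq_minAngle h0 h) hθ.le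
      _ = (Real.sqrt (minAngle γ) ^ 3) ^ 2 := by
        rw [← pow_mul, mul_comm 3 2, pow_mul, h4]
        ring
  have h7 : Real.sqrt (2 * (saddleEnergy γ - 1)) ≤
      Real.sqrt (2 * (saddleEnergy γ - 1 + γ * minAngle γ)) := Real.sqrt_le_sqrt (by linarith)
  have h8 : 0 < Real.sqrt (2 * (saddleEnergy γ - 1)) := Real.sqrt_pos.2 (by linarith)
  rw [inv_eq_one_div, div_le_div_iff₀ (by positivity) (by positivity)]
  calc 1 * (_ + _) ≤ 2 * Real.sqrt (minAngle γ) ^ 3 := by linarith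
    _ = Real.sqrt (minAngle γ) ^ 2 * (2 * Real.sqrt (minAngle γ)) := by ring
    _ = minAngle γ * (2 * Real.sqrt (minAngle γ)) := by rw [h4]

lemma continuous_minAngle : Continuous minAngle := by
  unfold minAngle
  fun_prop

lemma continuous_saddleEnergy : Continuous saddleEnergy := by
  unfold saddleEnergy
  fun_prop

lemma tendsto_minAngle_zero : Tendsto minAngle (𝓝[>] 0) (𝓝[>] 0) := by
  refine tendsto_nhdsWithin_iff.2 ⟨?_, ?_⟩
  · have := continuous_minAngle.tendsto 0
    rw [minAngle, mul_zero, sub_zero, Real.arccos_one] at this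
    exact this.mono_left nhdsWithin_le_nhds
  · filter_upwards [self_mem_nhdsWithin] with γ hγ using Set.mem_Ioi.2 (minAngle_pos hγ)

lemma eventually_pos_and_le_inv_pi : ∀ᶠ γ in 𝓝[>] (0 : ℝ), 0 < γ ∧ γ ≤ 1 / π := by
  filter_upwards [Ioc_mem_nhdsGT (show (0 : ℝ) < 1 / π by positivity)] with γ hγ using hγ

lemma tendsto_minHalfLength_zero : Tendsto minHalfLength (𝓝[>] 0) (𝓝 0) := by
  refine tendsto_of_tendsto_of_tendsto_of_le_of_le' tendsto_const_nhds
    (tendsto_minAngle_zero.mono_right nhdsWithin_le_nhds) ?_ ?_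
  · filter_upwards [eventually_pos_and_le_inv_pi] with γ hγ using (minHalfLength_pos hγ.1 hγ.2).le
  · filter_upwards [eventually_pos_and_le_inv_pi] with γ hγ using
      minHalfLength_le_minAngle hγ.1 hγ.2

lemma tendsto_maxHalfLength_atTop : Tendsto maxHalfLength (𝓝[>] 0) atTop := by
  have h1 : Tendsto (fun t => 2 * Real.sqrt t) (𝓝[>] 0) (𝓝[>] 0) := by
    refine tendsto_nhdsWithin_iff.2 ⟨?_, ?_⟩
    · have := (Real.continuous_sqrt.const_mul 2).tendsto 0
      rw [Real.sqrt_zero, mul_zero] at this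
      exact this.mono_left nhdsWithin_le_nhds
    · filter_upwards [self_mem_nhdsWithin] with t ht using
        Set.mem_Ioi.2 (mul_pos two_pos (Real.sqrt_pos.2 ht))
  refine tendsto_atTop_mono' _ ?_
    (tendsto_inv_nhdsGT_zero.comp (h1.comp tendsto_minAngle_zero))
  filter_upwards [eventually_pos_and_le_inv_pi] with γ hγ using le_maxHalfLength hγ.1 hγ.2

lemma minAngle_inv_pi : minAngle (1 / π) = π := by
  rw [minAngle, show 1 - 2 * π * (1 / π) = -1 by field_simp; norm_num, Real.arccos_neg_one]

lemma pi_mul_saddleEnergy_inv_pi :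
    π * saddleEnergy (1 / π) = Real.arcsin (1 / π) + Real.sqrt (π ^ 2 - 1) := by
  have h1 : π * Real.sqrt (1 - (1 / π) ^ 2) = Real.sqrt (π ^ 2 - 1) := by
    rw [show π ^ 2 - 1 = π ^ 2 * (1 - (1 / π) ^ 2) by field_simp,
      Real.sqrt_mul (by positivity), Real.sqrt_sq Real.pi_pos.le]
  rw [saddleEnergy, Real.cos_arcsin, mul_add, h1, ← mul_assoc, mul_one_div_cancel Real.pi_ne_zero]
  ring

lemma Lstar_eq : Lstar = (Real.sqrt (2 * saddleEnergy (1 / π)) -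
    Real.sqrt (2 * (saddleEnergy (1 / π) - 1))) / (2 * (1 / π)) := by
  have h1 : ∀ u, Real.sqrt (π / 2 * (π * u)) = Real.sqrt (2 * u) * (π / 2) := by
    intro u
    rw [show π / 2 * (π * u) = 2 * u * (π / 2) ^ 2 by ring,
      Real.sqrt_mul' _ (by positivity), Real.sqrt_sq (by positivity)]
  rw [Lstar, ← pi_mul_saddleEnergy_inv_pi, h1, show π * saddleEnergy (1 / π) - π =
    π * (saddleEnergy (1 / π) - 1) by ring, h1]
  field_simp

lemma tendsto_minHalfLength_Lstar : Tendsto minHalfLength (𝓝[<] (1 / π)) (𝓝 Lstar) := by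
  have h1 := continuous_minAngle
  have h2 := continuous_saddleEnergy
  have h3 : ContinuousAt minHalfLength (1 / π) :=
    ContinuousAt.div (by fun_prop) (by fun_prop) (by positivity)
  have h4 : minHalfLength (1 / π) = Lstar := by
    rw [minHalfLength, Lstar_eq, minAngle_inv_pi, one_div_mul_cancel Real.pi_ne_zero]
    ring_nf
  exact h4 ▸ h3.tendsto.mono_left nhdsWithin_le_nhds

lemma tendsto_maxHalfLength_Lstar : Tendsto maxHalfLength (𝓝[<] (1 / π)) (𝓝 Lstar) := by
  have h1 := continuous_minAngle
  have h2 := continuous_saddleEnergy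
  have h3 : ContinuousAt maxHalfLength (1 / π) :=
    ContinuousAt.div (by fun_prop) (by fun_prop) (by positivity)
  have h4 : maxHalfLength (1 / π) = Lstar := by
    rw [maxHalfLength, Lstar_eq, minAngle_inv_pi, one_div_mul_cancel Real.pi_ne_zero]
    ring_nf
  exact h4 ▸ h3.tendsto.mono_left nhdsWithin_le_nhds

lemma exists_two_pinnedFluxons {γ L : ℝ} (h0 : 0 < γ) (h : γ ≤ 1 / π) (hL : minHalfLength γ < L)
    (hL' : L < maxHalfLength γ) :
    ∃ φ ψ : ℝ → ℝ, φ ≠ ψ ∧ IsPinnedFluxon L 0 γ φ ∧ IsPinnedFluxon L 0 γ ψ := by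
  have hθ := minAngle_le_pi γ
  have hpos := (minHalfLength_pos h0 h).trans hL
  have hc := continuous_speedDrop γ (-γ) (saddleEnergy γ)
  have hπ : speedDrop γ (-γ) (saddleEnergy γ) π < 2 * γ * L := by
    rw [speedDrop_pi h0 h]
    gcongr
  have hmax : 2 * γ * L < 2 * γ * maxHalfLength γ := by gcongr
  obtain ⟨x, hx, hxL⟩ := intermediate_value_Icc' hθ hc.continuousOn
    ⟨hπ.le, hmax.le.trans (le_speedDrop_minAngle h0 h)⟩
  obtain ⟨y, hy, hyL⟩ := intermediate_value_Icc (show π ≤ 2 * π - minAngle γ by linarith)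
    hc.continuousOn ⟨hπ.le, hmax.le.trans (speedDrop_two_pi_sub_minAngle h0 h).ge⟩
  obtain ⟨φ, hφ, hφx⟩ := exists_isPinnedFluxon h0 h hpos ⟨hx.1, by linarith [hx.2]⟩ hxL
  obtain ⟨ψ, hψ, hψy⟩ := exists_isPinnedFluxon h0 h hpos ⟨by linarith [hy.1], hy.2⟩ hyL
  refine ⟨φ, ψ, ?_, hφ, hψ⟩
  rintro rfl
  have : x = π := le_antisymm hx.2 (by rw [← hφx, hψy]; exact hy.1)
  rw [this] at hxL
  exact hπ.ne hxL

/-- Existence theorem for pinned fluxons with `d = 0` and bias current `0 < γ ≤ 1/π`: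
there are `0 < L_min(γ) ≤ L_max(γ) < ∞` such that for `L` strictly between them at
least two pinned fluxons exist, at least one exists at the endpoints, at most `6`
exist simultaneously for any `L ∈ [L_min, L_max]`; `L_min → 0` and `L_max → ∞` as
`γ ↓ 0`; both converge to the explicit value `Lstar` as `γ ↑ 1/π`; and no pinned
fluxons exist for `γ > 1/π`. -/
theorem stmt5 :
    ∃ Lmin Lmax : ℝ → ℝ,
      (∀ γ : ℝ, 0 < γ → γ ≤ 1 / π →
        0 < Lmin γ ∧ Lmin γ ≤ Lmax γ ∧
        (∀ L : ℝ, Lmin γ < L → L < Lmax γ →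
          ∃ φ ψ : ℝ → ℝ, φ ≠ ψ ∧ IsPinnedFluxon L 0 γ φ ∧ IsPinnedFluxon L 0 γ ψ) ∧
        (∃ φ : ℝ → ℝ, IsPinnedFluxon (Lmin γ) 0 γ φ) ∧
        (∃ φ : ℝ → ℝ, IsPinnedFluxon (Lmax γ) 0 γ φ) ∧
        (∀ L : ℝ, Lmin γ ≤ L → L ≤ Lmax γ →
          {φ : ℝ → ℝ | IsPinnedFluxon L 0 γ φ}.Finite ∧
          {φ : ℝ → ℝ | IsPinnedFluxon L 0 γ φ}.ncard ≤ 6)) ∧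
      Tendsto Lmin (𝓝[>] (0 : ℝ)) (𝓝 0) ∧
      Tendsto Lmax (𝓝[>] (0 : ℝ)) atTop ∧
      Tendsto Lmin (𝓝[<] (1 / π)) (𝓝 Lstar) ∧
      Tendsto Lmax (𝓝[<] (1 / π)) (𝓝 Lstar) ∧
      (∀ γ L : ℝ, 1 / π < γ → 0 < L → ¬ ∃ φ : ℝ → ℝ, IsPinnedFluxon L 0 γ φ) := by
  refine ⟨minHalfLength, maxHalfLength, fun γ h0 h => ?_, tendsto_minHalfLength_zero,
    tendsto_maxHalfLength_atTop, tendsto_minHalfLength_Lstar, tendsto_maxHalfLength_Lstar,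
    fun γ L hγ hL ⟨φ, hφ⟩ => hγ.not_ge (hφ.le_inv_pi hL)⟩
  have hmin := minHalfLength_pos h0 h
  have hle := minHalfLength_le_maxHalfLength h0 h
  have hθ := minAngle_le_pi γ
  refine ⟨hmin, hle, fun L => exists_two_pinnedFluxons h0 h, ?_, ?_, fun L hL hL' => ?_⟩
  · obtain ⟨φ, hφ, -⟩ := exists_isPinnedFluxon h0 h hmin ⟨hθ, by linarith⟩ (speedDrop_pi h0 h)
    exact ⟨φ, hφ⟩
  · obtain ⟨φ, hφ, -⟩ := exists_isPinnedFluxon h0 h (hmin.trans_le hle) ⟨by linarith, le_rfl⟩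
      (speedDrop_two_pi_sub_minAngle h0 h)
    exact ⟨φ, hφ⟩
  · exact Set.encard_le_coe_iff_finite_ncard_le.1
      (IsPinnedFluxon.encard_le_six h0 h (hmin.trans_le hL) hL')
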